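/- For each triple of positive integers (m, r, l) there exists a bound κ(m, r, l) with the following property. Let (R, m_R) be a Noetherian local ring of mixed characteristic (char R = 0 and char(R/m_R) = p for a prime p) whose maximal ideal m_R is generated by at most m elements, and let F_• : 0 → F_s → F_{s−1} → ⋯ → F_1 → F_0 → 0 be a finite complex of finitely generated free R-modules each of rank at most r. Suppose that for every i > 0 the homology module H_i(F_•) has length at most l, and that H_0(F_•) has a nonzero minimal generator μ (i.e., μ ∉ m_R·H_0(F_•)) such that the submodule Rμ of H_0(F_•) has length at most l. If p ≥ κ(m, r, l), then s is at least the Krull dimension of R. -/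

import Mathlib

/-!
STATEMENT 19 (Asymptotic Improved New Intersection Theorem): for each triple of positive
integers `(m, r, l)` there is a bound `κ(m, r, l)`: whenever `(R, m_R)` is a Noetherian
local ring of mixed characteristic `p ≥ κ(m, r, l)` whose maximal ideal is generated by
at most `m` elements, and `F_• : 0 → F_s → ⋯ → F_0 → 0` is a finite complex of finitely
generated free `R`-modules of rank at most `r` (realized as `F_i = R^{k i}` with
`k i ≤ r`, `k i = 0` for `i > s`) such that every `H_i(F_•)` with `i > 0` has length at
most `l` and `H_0(F_•)` has a nonzero minimal generator `μ` with `length(Rμ) ≤ l`, then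
`s ≥ dim R`.
-/

universe u

/-- The length of a module, i.e. the longest chain of submodules. -/
noncomputable def modLength (R : Type u) (M : Type u) [Ring R] [AddCommGroup M]
    [Module R M] : WithBot ℕ∞ :=
  Order.krullDim (Submodule R M)

section

open scoped Matrix

/-- The elementary data extracted from a complex of free modules. -/
def ComplexCertificate {R : Type*} [CommRing R] (r d : ℕ) (y : Fin d → R) (δ : Fin r → R) :
    Prop :=
  ∃ (D : ℕ → Matrix (Fin r) (Fin r) R) (f : ℕ → Fin r → R) (g : ℕ → Fin d → Fin r → R)
    (w : Fin r → R),
    (∀ j, D j * D (j + 1) = 0) ∧ f d = 0 ∧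
    (∀ j : Fin d, D j *ᵥ f (j + 1) = y j • f j + ∑ i with i.val < j.val, y i • g j i) ∧
    w ⬝ᵥ f 0 = 1 ∧ w ᵥ* D 0 = δ

theorem ComplexCertificate.map {R S : Type*} [CommRing R] [CommRing S] {r d : ℕ} {y : Fin d → R}
    {δ : Fin r → R} (h : ComplexCertificate r d y δ) (φ : R →+* S) :
    ComplexCertificate r d (fun i => φ (y i)) (fun i => φ (δ i)) := by
  obtain ⟨D, f, g, w, h1, h2, h3, h4, h5⟩ := h
  refine ⟨fun j => (D j).map φ, fun j i => φ (f j i), fun j i a => φ (g j i a), fun i => φ (w i),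
    fun j => ?_, ?_, fun j => ?_, ?_, ?_⟩
  · rw [← Matrix.map_mul, h1]; simp
  · ext i; simp [h2]
  · ext a
    have := congrArg φ (congrFun (h3 j) a)
    simpa [Matrix.mulVec, dotProduct, map_sum, Finset.sum_apply] using this
  · simpa [dotProduct, map_sum] using congrArg φ h4
  · ext a
    have := congrArg φ (congrFun h5 a)
    simpa [Matrix.vecMul, dotProduct, map_sum] using this

theorem Fin.sum_filter_val_lt_succ {d : ℕ} {M : Type*} [AddCommMonoid M] (j : Fin d)
    (F : Fin d → M) :
    ∑ i with i.val < j.val + 1, F i = F j + ∑ i with i.val < j.val, F i := by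
  have : (Finset.univ.filter fun i : Fin d => i.val < j.val + 1) =
      insert j (Finset.univ.filter fun i : Fin d => i.val < j.val) := by
    ext i
    simp only [Finset.mem_filter, Finset.mem_univ, true_and, Finset.mem_insert, Fin.ext_iff]
    omega
  rw [this, Finset.sum_insert (by simp)]

theorem ComplexCertificate.pow_mem_span {R : Type*} [CommRing R] {r d : ℕ} {y : Fin d → R}
    {δ : Fin r → R} (h : ComplexCertificate r d y δ) (c : R)
    (hreg : ∀ (j : Fin d) (x : R) (v : Fin d → R), y j * x = ∑ i with i.val < j.val, y i * v i →
      ∃ v' : Fin d → R, c * x = ∑ i with i.val < j.val, y i * v' i) :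
    c ^ d ∈ Ideal.span (Set.range δ) := by
  obtain ⟨D, f, g, w, h1, h2, h3, h4, h5⟩ := h
  have key : ∀ t : ℕ, ∀ j : ℕ, t + j = d → ∃ (u : Fin r → R) (v : Fin d → Fin r → R),
      c ^ t • f j = D j *ᵥ u + ∑ i with i.val < j, y i • v i := by
    intro t
    induction t with
    | zero =>
      intro j hj
      refine ⟨0, 0, ?_⟩
      have : j = d := by omega
      subst this
      simp [h2]
    | succ t ih =>
      intro j hj
      obtain ⟨u, v, huv⟩ := ih (j + 1) (by omega)
      have hjd : j < d := by omega
      have e1 := congrArg (D j *ᵥ ·) huv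
      have e3 := h3 ⟨j, hjd⟩
      have e4 := Fin.sum_filter_val_lt_succ (⟨j, hjd⟩ : Fin d) (fun i => y i • v i)
      simp only at e1 e3 e4
      rw [Matrix.mulVec_smul, e3, e4, Matrix.mulVec_add, Matrix.mulVec_add, Matrix.mulVec_mulVec,
        h1, Matrix.zero_mulVec, zero_add, Matrix.mulVec_smul, Matrix.mulVec_sum] at e1
      have e5 : ∀ a, y ⟨j, hjd⟩ * (c ^ t * f j a - (D j *ᵥ v ⟨j, hjd⟩) a) =
          ∑ i with i.val < j, y i * ((D j *ᵥ v i) a - c ^ t * g j i a) := by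
        intro a
        have := congrFun e1 a
        simp only [Pi.smul_apply, Pi.add_apply, smul_eq_mul, Finset.sum_apply,
          Matrix.mulVec_smul] at this
        simp only [mul_sub, Finset.sum_sub_distrib]
        have e6 : ∑ i with i.val < j, y i * (c ^ t * g j i a) =
            c ^ t * ∑ i with i.val < j, y i * g j i a := by
          rw [Finset.mul_sum]; exact Finset.sum_congr rfl fun i _ => by ring
        rw [e6]
        linear_combination this
      choose v' hv' using fun a => hreg ⟨j, hjd⟩ _ _ (e5 a)
      refine ⟨c • v ⟨j, hjd⟩, fun i a => v' a i, ?_⟩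
      ext a
      have := hv' a
      simp only [Pi.smul_apply, Pi.add_apply, smul_eq_mul, Finset.sum_apply,
          Matrix.mulVec_smul]
      rw [← this]; ring
  obtain ⟨u, v, huv⟩ := key d 0 (by simp)
  have e := congrArg (w ⬝ᵥ ·) huv
  simp only [dotProduct_smul, h4, dotProduct_add, Matrix.dotProduct_mulVec, h5] at e
  simp only [Nat.not_lt_zero, Finset.filter_false, Finset.sum_empty, dotProduct_zero, add_zero,
    smul_eq_mul, mul_one] at e
  rw [e]
  exact Ideal.sum_mem _ fun i _ => Ideal.mul_mem_right _ _ (Ideal.subset_span ⟨i, rfl⟩)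

theorem ComplexCertificate.exists_finset {R : Type*} [CommRing R] {r d : ℕ} {y : Fin d → R}
    {δ : Fin r → R} (h : ComplexCertificate r d y δ) :
    ∃ S : Finset R, ∀ G : Subring R, (S : Set R) ⊆ G → ∀ (y' : Fin d → G) (δ' : Fin r → G),
      (∀ i, (y' i : R) = y i) → (∀ i, (δ' i : R) = δ i) → ComplexCertificate r d y' δ' := by
  classical
  obtain ⟨D, f, g, w, h1, h2, h3, h4, h5⟩ := h
  let S : Finset R := (Finset.univ.image fun x : Fin (d + 1) × Fin r × Fin r => D x.1 x.2.1 x.2.2) ∪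
    (Finset.univ.image fun x : Fin (d + 1) × Fin r => f x.1 x.2) ∪
    (Finset.univ.image fun x : Fin (d + 1) × Fin d × Fin r => g x.1 x.2.1 x.2.2) ∪
    (Finset.univ.image w)
  refine ⟨S, fun G hG y' δ' hy hδ => ?_⟩
  have hD : ∀ j, j ≤ d → ∀ a b, D j a b ∈ G := fun j hj a b => hG <| by
    simp only [S, Finset.coe_union, Finset.coe_image, Set.mem_union]
    exact Or.inl (Or.inl (Or.inl ⟨(⟨j, by omega⟩, a, b), by simp⟩))
  have hf : ∀ j, j ≤ d → ∀ a, f j a ∈ G := fun j hj a => hG <| by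
    simp only [S, Finset.coe_union, Finset.coe_image, Set.mem_union]
    exact Or.inl (Or.inl (Or.inr ⟨(⟨j, by omega⟩, a), by simp⟩))
  have hg : ∀ j, j ≤ d → ∀ i a, g j i a ∈ G := fun j hj i a => hG <| by
    simp only [S, Finset.coe_union, Finset.coe_image, Set.mem_union]
    exact Or.inl (Or.inr ⟨(⟨j, by omega⟩, i, a), by simp⟩)
  have hw : ∀ a, w a ∈ G := fun a => hG <| by
    simp only [S, Finset.coe_union, Finset.coe_image, Set.mem_union]
    exact Or.inr ⟨a, by simp⟩
  refine ⟨fun j => if hj : j ≤ d then Matrix.of fun a b => ⟨D j a b, hD j hj a b⟩ else 0,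
    fun j => if hj : j ≤ d then fun a => ⟨f j a, hf j hj a⟩ else 0,
    fun j => if hj : j ≤ d then fun i a => ⟨g j i a, hg j hj i a⟩ else 0,
    fun a => ⟨w a, hw a⟩, fun j => ?_, ?_, fun j => ?_, ?_, ?_⟩
  · by_cases hj : j + 1 ≤ d
    · beta_reduce
      rw [dif_pos hj, dif_pos (by omega)]
      ext a b
      simpa [Matrix.mul_apply] using congrFun (congrFun (h1 j) a) b
    · beta_reduce
      rw [dif_neg hj, mul_zero]
  · beta_reduce
    rw [dif_pos le_rfl]
    ext a
    simpa using congrFun h2 a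
  · have := j.isLt
    beta_reduce
    rw [dif_pos (by omega), dif_pos (by omega), dif_pos (by omega), dif_pos (by omega)]
    ext a
    simpa [Matrix.mulVec, dotProduct, hy] using congrFun (h3 j) a
  · apply Subtype.ext
    simpa [dotProduct] using h4
  · ext a
    beta_reduce
    rw [dif_pos (by omega)]
    simpa [Matrix.vecMul, dotProduct, hδ] using congrFun h5 a

end

section

open scoped Matrix

theorem MvPowerSeries.exists_eq_sum_X_pow_mul {d : ℕ} {K : Type*} [CommRing K] (M j : ℕ)
    (x : MvPowerSeries (Fin d) K)
    (hx : ∀ e : Fin d →₀ ℕ, (∀ i : Fin d, i.val < j → e i < M) → coeff e x = 0) :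
    ∃ v : Fin d → MvPowerSeries (Fin d) K,
      x = ∑ i with i.val < j, (X i : MvPowerSeries (Fin d) K) ^ M * v i := by
  classical
  obtain ⟨V, hV⟩ : ∃ V : Fin d → MvPowerSeries (Fin d) K, ∀ i e, coeff e (V i) =
      if ∀ i' < i, e i' < M then coeff (e + Finsupp.single i M) x else 0 := ⟨_, fun _ _ => rfl⟩
  refine ⟨V, ?_⟩
  ext e
  rw [map_sum]
  have hterm : ∀ i : Fin d, coeff e ((X i : MvPowerSeries (Fin d) K) ^ M * V i) =
      if M ≤ e i ∧ ∀ i' < i, e i' < M then coeff e x else 0 := by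
    intro i
    rw [X_pow_eq, coeff_monomial_mul]
    simp only [Finsupp.single_le_iff, one_mul]
    by_cases h : M ≤ e i
    · rw [if_pos h]
      have h1 : e - Finsupp.single i M + Finsupp.single i M = e :=
        tsub_add_cancel_of_le (Finsupp.single_le_iff.2 h)
      have h2 : ∀ i' < i, (e - Finsupp.single i M) i' = e i' := by
        intro i' hi'
        simp [hi'.ne']
      rw [hV, h1]
      congr 1
      simp only [h, true_and, eq_iff_iff]
      exact forall₂_congr fun i' hi' => by rw [h2 i' hi']
    · simp [h]
  simp only [hterm]
  by_cases h : ∀ i : Fin d, i.val < j → e i < M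
  · rw [hx e h]
    simp
  · push Not at h
    obtain ⟨i0, hi0, hi0M⟩ : ∃ i : Fin d, (i.val < j ∧ M ≤ e i) ∧
        ∀ i' : Fin d, (i'.val < j ∧ M ≤ e i') → i ≤ i' := by
      obtain ⟨i, hi⟩ := h
      obtain ⟨m, hm⟩ := Finset.exists_minimal (s := Finset.univ.filter fun i : Fin d =>
        i.val < j ∧ M ≤ e i) ⟨i, by simpa using hi⟩
      refine ⟨m, by simpa using hm.1, fun i' hi' => ?_⟩
      by_contra hlt
      exact hlt (hm.2 (by simpa using hi') (le_of_not_ge hlt))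
    rw [Finset.sum_eq_single i0]
    · rw [if_pos]
      refine ⟨hi0.2, fun i' hi' => ?_⟩
      by_contra hcon
      exact absurd (hi0M i' ⟨lt_trans hi' hi0.1, not_lt.1 hcon⟩) (not_le.2 hi')
    · intro i hi hne
      rw [if_neg]
      rintro ⟨h1, h2⟩
      have : i0 ≤ i := hi0M i ⟨by simpa using hi, h1⟩
      exact absurd hi0.2 (not_le.2 (h2 i0 (lt_of_le_of_ne this hne.symm)))
    · intro hn
      exact absurd (by simpa using hi0.1) hn

theorem MvPowerSeries.X_pow_weaklyRegular {d : ℕ} {K : Type*} [CommRing K] (M : ℕ) (j : Fin d)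
    (x : MvPowerSeries (Fin d) K) (v : Fin d → MvPowerSeries (Fin d) K)
    (h : (X j : MvPowerSeries (Fin d) K) ^ M * x = ∑ i with i.val < j.val, X i ^ M * v i) :
    ∃ v' : Fin d → MvPowerSeries (Fin d) K, x = ∑ i with i.val < j.val, X i ^ M * v' i := by
  classical
  apply MvPowerSeries.exists_eq_sum_X_pow_mul
  intro e he
  have := congrArg (coeff (Finsupp.single j M + e)) h
  rw [X_pow_eq, coeff_add_monomial_mul, one_mul] at this
  rw [this, map_sum]
  refine Finset.sum_eq_zero fun i hi => ?_
  have hi' : i.val < j.val := by simpa using hi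
  rw [X_pow_eq, coeff_monomial_mul, if_neg]
  have h2 : j ≠ i := by rintro rfl; exact lt_irrefl _ hi'
  simp only [Finsupp.single_le_iff, Finsupp.add_apply, Finsupp.single_apply, h2, if_false, zero_add,
    not_le]
  exact he i hi'

theorem MvPowerSeries.coeff_eq_zero_of_mem_span_X_pow {d : ℕ} {K : Type*} [CommRing K] (t : ℕ)
    (x : MvPowerSeries (Fin d) K)
    (hx : x ∈ Ideal.span (Set.range (X : Fin d → MvPowerSeries (Fin d) K)) ^ t)
    (e : Fin d →₀ ℕ) (he : e.degree < t) : coeff e x = 0 := by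
  refine coeff_of_lt_order (lt_of_lt_of_le (by exact_mod_cast he) (?_ : (t : ℕ∞) ≤ x.order))
  clear he
  induction t generalizing x with
  | zero => simp
  | succ t ih =>
    rw [pow_succ'] at hx
    refine Submodule.mul_induction_on hx (fun a ha b hb => ?_)
      fun a b ha hb => le_trans (le_min ha hb) (min_order_le_add)
    refine le_trans ?_ (le_order_mul)
    rw [Nat.cast_add, add_comm]
    refine add_le_add ?_ (ih b hb)
    refine Submodule.span_induction (p := fun a _ => ((1 : ℕ) : ℕ∞) ≤ a.order) ?_ (by simp)
      (fun a a' _ _ h h' => le_trans (le_min h h') (min_order_le_add))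
      (fun s a _ h => le_trans (le_trans h le_add_self) le_order_mul) ha
    rintro _ ⟨i, rfl⟩
    refine nat_le_order fun e he => ?_
    have : e = 0 := by simpa [Finsupp.degree_eq_zero_iff] using he
    subst this
    simp

/-- A ring of prime characteristic `R` containing a lattice over a domain `A` carries no
certificate for powers of a sequence in `A` all of whose powers are regular. -/
theorem ComplexCertificate.not_of_charP {d r h N n p : ℕ} {A : Type*} [CommRing A] [IsDomain A]
    [CharP A p] (hp : p.Prime) {R : Type*} [CommRing R] [Algebra A R] (X : Fin d → A)
    (hreg : ∀ (M : ℕ) (j : Fin d) (x : A) (v : Fin d → A),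
      X j ^ M * x = ∑ i with i.val < j.val, X i ^ M * v i →
      ∃ v' : Fin d → A, x = ∑ i with i.val < j.val, X i ^ M * v' i)
    (hsep : ∀ x : A, (∀ t, x ∈ Ideal.span (Set.range X) ^ t) → x = 0)
    (hh : 0 < h) (α : (Fin h → A) →ₗ[A] R) (β : R →ₗ[A] (Fin h → A))
    (c : A) (hc : c ≠ 0) (hαβ : ∀ x, α (β x) = c • x)
    (hβα : ∀ x, β (α x) = c • x) (δ : Fin r → R)
    (hδ : ∀ i, δ i ^ n ∈ Ideal.span (Set.range fun i : Fin d => algebraMap A R (X i))) :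
    ¬ ComplexCertificate r d (fun i : Fin d => algebraMap A R (X i ^ N)) δ := by
  intro hcert
  set J := Ideal.span (Set.range X) with hJ
  have hJR : Ideal.span (Set.range fun i : Fin d => algebraMap A R (X i)) =
      J.map (algebraMap A R) := by
    rw [Ideal.map_span, ← Set.range_comp]; rfl
  rw [hJR] at hδ
  have hpR : (p : R) = 0 := by
    rw [← map_natCast (algebraMap A R), CharP.cast_eq_zero, map_zero]
  have hnt : Nontrivial R := by
    by_contra hcon
    rw [not_nontrivial_iff_subsingleton] at hcon
    have h1 := hβα (fun _ => 1)
    rw [Subsingleton.elim (α _) 0, map_zero] at h1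
    exact hc (by simpa using (congrFun h1 ⟨0, hh⟩).symm)
  have : CharP R p := (CharP.charP_iff_prime_eq_zero hp).2 hpR
  have : Fact p.Prime := ⟨hp⟩
  have : ExpChar R p := ExpChar.prime hp
  have key : ∀ t : ℕ, algebraMap A R c ^ d ∈ (J.map (algebraMap A R)) ^ t := by
    intro t
    obtain ⟨e, he⟩ : ∃ e, n * t ≤ p ^ e := ⟨n * t, (Nat.lt_pow_self hp.one_lt).le⟩
    have h1 := hcert.map (iterateFrobenius R p e)
    have h2 := h1.pow_mem_span (algebraMap A R c) ?_
    · refine (Ideal.span_le.2 ?_ : _ ≤ J.map (algebraMap A R) ^ t) h2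
      rintro _ ⟨i, rfl⟩
      simp only [iterateFrobenius_def, SetLike.mem_coe]
      refine Ideal.pow_mem_of_pow_mem _ ?_ he
      rw [pow_mul]
      exact Ideal.pow_mem_pow (hδ i) t
    · intro j x v hx
      simp only [iterateFrobenius_def, ← map_pow, ← pow_mul, ← Algebra.smul_def] at hx ⊢
      have hx' : ∀ a, X j ^ (N * p ^ e) * β x a =
          ∑ i with i.val < j.val, X i ^ (N * p ^ e) * β (v i) a := by
        intro a
        have := congrFun (congrArg β hx) a
        simpa [map_sum, Finset.sum_apply] using this
      choose v' hv' using fun a => hreg _ j _ _ (hx' a)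
      refine ⟨fun i => α fun a => v' a i, ?_⟩
      rw [← hαβ]
      simp only [← map_smul, ← map_sum]
      congr 1
      ext1 a
      rw [hv']
      simp [Finset.sum_apply]
  have key2 : ∀ t : ℕ, ∀ x ∈ (J.map (algebraMap A R)) ^ t, ∀ a, β x a ∈ J ^ t := by
    intro t x hx
    rw [← Ideal.map_pow, ← Submodule.restrictScalars_mem A, ← Ideal.smul_top_eq_map] at hx
    intro a
    refine Submodule.smul_induction_on hx (fun b hb y _ => ?_)
      fun y z hy hz => by simpa using add_mem hy hz
    simpa using Ideal.mul_mem_right _ _ hb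
  have h3 : c ^ d * c = 0 := by
    refine hsep _ fun t => ?_
    have := key2 t (algebraMap A R c ^ d * α fun _ => 1) (Ideal.mul_mem_right _ _ (key t)) ⟨0, hh⟩
    rw [← map_pow, ← Algebra.smul_def, map_smul, hβα] at this
    simpa using this
  exact mul_ne_zero (pow_ne_zero _ hc) hc h3

theorem MvPowerSeries.eq_zero_of_forall_mem_span_X_pow {d : ℕ} {K : Type*} [CommRing K]
    (x : MvPowerSeries (Fin d) K)
    (hx : ∀ t, x ∈ Ideal.span (Set.range (X : Fin d → MvPowerSeries (Fin d) K)) ^ t) : x = 0 := by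
  ext e
  exact coeff_eq_zero_of_mem_span_X_pow _ x (hx (e.degree + 1)) e (Nat.lt_succ_self _)

end

section

open scoped Matrix

theorem exists_chain_of_annihilator {R : Type u} [CommRing R] (d : ℕ) :
    ∀ (F : ℕ → Type u) [∀ j, AddCommGroup (F j)] [∀ j, Module R (F j)]
      (D : ∀ j, F (j + 1) →ₗ[R] F j) (_ : ∀ j x, D j (D (j + 1) x) = 0) (J : Ideal R) (e : F 0)
      (_ : ∀ j, ∀ a ∈ J, ∀ v, D j v = 0 → ∃ w, D (j + 1) w = a • v)
      (_ : ∀ a ∈ J, ∃ w, D 0 w = a • e)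
      (y : Fin d → R) (_ : ∀ i : Fin d, y i ∈ J ^ 2 ^ i.val),
      ∃ (f : ∀ j, F j) (g : ∀ j, Fin d → F j), f 0 = e ∧
        ∀ j : Fin d, D j (f (j + 1)) = y j • f j + ∑ i with i.val < j.val, y i • g j i := by
  induction d with
  | zero =>
    intro F _ _ D _ J e _ _ y _
    exact ⟨fun j => match j with
      | 0 => e
      | _ + 1 => 0, fun _ _ => 0, rfl, fun j => j.elim0⟩
  | succ d ih =>
    intro F _ _ D hD J e hH hE y hy
    obtain ⟨f₁, hf₁⟩ := hE (y 0) (by simpa using hy 0)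
    let C : ℕ → Type u := fun j => F (j + 1) × F j
    let DC : ∀ j, C (j + 1) →ₗ[R] C j := fun j =>
      LinearMap.prod (D (j + 1) ∘ₗ LinearMap.fst R _ _ + y 0 • LinearMap.snd R _ _)
        (-(D j ∘ₗ LinearMap.snd R _ _))
    have hDC : ∀ j (x : C (j + 1)), DC j x = (D (j + 1) x.1 + y 0 • x.2, - D j x.2) :=
      fun j x => rfl
    have hDC0 : ∀ j x, DC j (DC (j + 1) x) = 0 := by
      intro j x
      rw [hDC, hDC]
      refine Prod.ext ?_ ?_
      · simp [hD]
      · simp [hD]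
    have hHC : ∀ j, ∀ a ∈ J * J, ∀ v, DC j v = 0 → ∃ w, DC (j + 1) w = a • v := by
      intro j a ha v hv
      rw [hDC, Prod.mk_eq_zero, neg_eq_zero] at hv
      refine Submodule.mul_induction_on ha (fun a ha b hb => ?_) fun a b ⟨w, hw⟩ ⟨w', hw'⟩ =>
        ⟨w + w', by rw [map_add, hw, hw', add_smul]⟩
      obtain ⟨g, hg⟩ := hH j a ha v.2 hv.2
      obtain ⟨u', hu'⟩ := hH (j + 1) b hb (a • v.1 + y 0 • g) (by
        rw [map_add, map_smul, map_smul, hg, smul_comm (y 0) a, ← smul_add, hv.1, smul_zero])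
      refine ⟨(u', -(b • g)), ?_⟩
      rw [hDC]
      refine Prod.ext ?_ ?_
      · change D _ u' + y 0 • -(b • g) = (a * b) • v.1
        rw [hu']
        module
      · change -D _ (-(b • g)) = (a * b) • v.2
        rw [map_neg, map_smul, hg]
        module
    have hEC : ∀ a ∈ J * J, ∃ w : C 1, DC 0 w = a • ((f₁, -e) : C 0) := by
      intro a ha
      refine Submodule.mul_induction_on ha (fun a ha b hb => ?_) fun a b ⟨w, hw⟩ ⟨w', hw'⟩ =>
        ⟨w + w', by rw [map_add, hw, hw', add_smul]⟩
      obtain ⟨v, hv⟩ := hE a ha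
      obtain ⟨w, hw⟩ := hH 0 b hb (a • f₁ - y 0 • v) (by
        rw [map_sub, map_smul, map_smul, hf₁, hv, smul_comm, sub_self])
      refine ⟨(w, b • v), ?_⟩
      rw [hDC]
      refine Prod.ext ?_ ?_
      · change D _ w + y 0 • (b • v) = (a * b) • f₁
        rw [hw]
        module
      · change -D _ (b • v) = (a * b) • -e
        rw [map_smul, hv]
        module
    obtain ⟨f, g, hf0, hfg⟩ := ih C DC hDC0 (J * J) ((f₁, -e) : C 0) hHC hEC (fun i => y i.succ)
      (fun i => by
        have := hy i.succ
        rwa [Fin.val_succ, pow_succ', pow_mul, pow_two] at this)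
    refine ⟨fun j => match j with
      | 0 => e
      | j + 1 => (f j).1, fun j => match j with
      | 0 => 0
      | j + 1 => Fin.cons (-(f (j + 1)).2) fun i => (g j i).1, rfl, fun j => ?_⟩
    refine Fin.cases ?_ (fun j => ?_) j
    · change D 0 (f 0).1 = y 0 • e + _
      simp only [hf0, hf₁, Fin.val_zero, Nat.not_lt_zero, Finset.filter_false]
      exact ((congrArg (y 0 • e + ·) Finset.sum_empty).trans (add_zero _)).symm
    · have h : D (j + 1) (f (j + 1)).1 + y 0 • (f (j + 1)).2 =
          y j.succ • (f j).1 + (∑ i with i.val < j.val, y i.succ • g j i).1 :=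
        congrArg Prod.fst (hfg j)
      have h1 : (∑ i with i.val < j.val, y i.succ • g j i).1 =
          ∑ i with i.val < j.val, y i.succ • (g j i).1 :=
        map_sum (LinearMap.fst R (F (j + 1)) (F j)) _ _
      have h2 : ∀ G : Fin (d + 1) → F (j.val + 1), ∑ i : Fin (d + 1) with i.val < j.succ.val, G i =
          G 0 + ∑ i : Fin d with i.val < j.val, G i.succ := by
        intro G
        rw [Finset.sum_filter, Fin.sum_univ_succ, Finset.sum_filter]
        simp
      have h3 := h2 (fun i => y i • (Fin.cons (-(f (j.val + 1)).2) fun i => (g j i).1 :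
        Fin (d + 1) → F (j.val + 1)) i)
      simp only [Fin.cons_zero, Fin.cons_succ] at h3
      refine Eq.trans ?_ (congrArg (y j.succ • (f j.val).1 + ·) h3).symm
      change D (j.val + 1) (f (j.val + 1)).1 = _
      rw [eq_sub_of_add_eq h, h1]
      module

theorem smul_eq_zero_of_krullDim_submodule_le {R : Type u} [CommRing R] [IsLocalRing R]
    {M : Type u} [AddCommGroup M] [Module R M] [IsNoetherian R M] (l : ℕ)
    (h : Order.krullDim (Submodule R M) ≤ l) (a : R)
    (ha : a ∈ IsLocalRing.maximalIdeal R ^ l) (x : M) : a • x = 0 := by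
  set m := IsLocalRing.maximalIdeal R
  suffices hs : m ^ l • (⊤ : Submodule R M) = ⊥ by
    have : a • x ∈ m ^ l • (⊤ : Submodule R M) := Submodule.smul_mem_smul ha trivial
    rwa [hs, Submodule.mem_bot] at this
  by_contra hne
  have hle : ∀ i j, i ≤ j → m ^ j • (⊤ : Submodule R M) ≤ m ^ i • ⊤ := fun i j hij =>
    Submodule.smul_mono_left (Ideal.pow_le_pow_right hij)
  have hlt : ∀ i, i ≤ l → m ^ (i + 1) • (⊤ : Submodule R M) < m ^ i • ⊤ := by
    intro i hi
    refine lt_of_le_of_ne (hle _ _ (Nat.le_succ i)) fun heq => hne ?_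
    rw [eq_bot_iff, ← Submodule.eq_bot_of_le_smul_of_le_jacobson_bot m (m ^ i • (⊤ : Submodule R M))
      (IsNoetherian.noetherian _) (by rw [← mul_smul, ← pow_succ', heq])
      (IsLocalRing.maximalIdeal_le_jacobson _)]
    exact hle _ _ hi
  let s : LTSeries (Submodule R M) :=
    { length := l + 1
      toFun := fun i => m ^ (l + 1 - i.val) • (⊤ : Submodule R M)
      step := fun i => by
        have := i.isLt
        have h1 : l + 1 - i.castSucc.val = (l + 1 - i.succ.val) + 1 := by simp; omega
        change m ^ (l + 1 - i.castSucc.val) • (⊤ : Submodule R M) <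
          m ^ (l + 1 - i.succ.val) • (⊤ : Submodule R M)
        rw [h1]
        exact hlt _ (by simp) }
  have h2 := le_trans (Order.LTSeries.length_le_krullDim s) h
  have h3 : s.length = l + 1 := rfl
  rw [h3] at h2
  have : l + 1 ≤ l := by exact_mod_cast h2
  omega

theorem exists_functional_of_notMem {R : Type u} [CommRing R] [IsLocalRing R] {k : ℕ}
    (U : Submodule R (Fin k → R)) (e : Fin k → R)
    (he : (U.mkQ e) ∉ IsLocalRing.maximalIdeal R • (⊤ : Submodule R ((Fin k → R) ⧸ U))) :
    ∃ φ : (Fin k → R) →ₗ[R] R, φ e = 1 ∧ ∀ x ∈ U, φ x ∈ IsLocalRing.maximalIdeal R := by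
  classical
  let κ := IsLocalRing.ResidueField R
  let red : (Fin k → R) →ₗ[R] (Fin k → κ) := (Algebra.linearMap R κ).compLeft (Fin k)
  let W : Submodule κ (Fin k → κ) :=
    { carrier := red '' U
      add_mem' := by
        rintro _ _ ⟨a, ha, rfl⟩ ⟨b, hb, rfl⟩
        exact ⟨a + b, add_mem ha hb, map_add _ _ _⟩
      zero_mem' := ⟨0, zero_mem _, map_zero _⟩
      smul_mem' := by
        rintro c _ ⟨a, ha, rfl⟩
        obtain ⟨c, rfl⟩ := IsLocalRing.residue_surjective c
        exact ⟨c • a, U.smul_mem c ha, by rw [map_smul]; rfl⟩ }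
  have hW : red e ∉ W := by
    rintro ⟨x, hx, hxe⟩
    apply he
    have h1 : U.mkQ e = U.mkQ (e - x) := by
      rw [map_sub, (Submodule.Quotient.mk_eq_zero U).2 hx |> fun h => (h : U.mkQ x = 0), sub_zero]
    have h2 : ∀ i, (e - x) i ∈ IsLocalRing.maximalIdeal R := by
      intro i
      rw [← IsLocalRing.residue_eq_zero_iff]
      have := congrFun hxe i
      simp only [red, LinearMap.compLeft_apply, Function.comp, Algebra.linearMap_apply] at this
      rw [Pi.sub_apply, map_sub, sub_eq_zero]
      exact this.symm
    rw [h1, pi_eq_sum_univ' (e - x), map_sum]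
    refine Submodule.sum_mem _ fun i _ => ?_
    rw [map_smul]
    exact Submodule.smul_mem_smul (h2 i) trivial
  obtain ⟨ψ, hψe, hψW⟩ := Submodule.exists_le_ker_of_notMem hW
  choose w hw using fun i => IsLocalRing.residue_surjective (ψ (Pi.single i 1))
  let φ₀ : (Fin k → R) →ₗ[R] R := ∑ i, w i • LinearMap.proj i
  have hφ₀ : ∀ x, IsLocalRing.residue R (φ₀ x) = ψ (red x) := by
    intro x
    have h1 : red x = ∑ i, IsLocalRing.residue R (x i) • (Pi.single i (1 : κ) : Fin k → κ) := by
      ext j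
      simp only [Finset.sum_apply, Pi.smul_apply, Pi.single_apply, smul_eq_mul, mul_ite, mul_one,
        mul_zero, Finset.sum_ite_eq, Finset.mem_univ, if_true]
      rfl
    rw [h1, map_sum]
    simp [φ₀, LinearMap.sum_apply, map_sum, hw, mul_comm]
  have hu : IsUnit (φ₀ e) := by
    rw [← IsLocalRing.notMem_maximalIdeal, ← IsLocalRing.residue_eq_zero_iff, hφ₀]
    exact hψe
  obtain ⟨u, hu⟩ := hu
  refine ⟨(↑u⁻¹ : R) • φ₀, by simp [← hu], fun x hx => ?_⟩
  rw [LinearMap.smul_apply, smul_eq_mul]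
  refine Ideal.mul_mem_left _ _ ?_
  rw [← IsLocalRing.residue_eq_zero_iff, hφ₀]
  exact hψW ⟨x, hx, rfl⟩

theorem exists_complexCertificate {R : Type u} [CommRing R] [IsLocalRing R] [IsNoetherianRing R]
    {r l s : ℕ} (k : ℕ → ℕ) (d : ∀ i : ℕ, ((Fin (k (i + 1)) → R) →ₗ[R] (Fin (k i) → R)))
    (hk : ∀ i, k i ≤ r) (hks : ∀ i, s < i → k i = 0) (hd : ∀ i, (d i).comp (d (i + 1)) = 0)
    (hH : ∀ i, modLength R
            (LinearMap.ker (d i) ⧸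
              Submodule.comap (LinearMap.ker (d i)).subtype (LinearMap.range (d (i + 1))))
          ≤ (l : WithBot ℕ∞))
    (μ : (Fin (k 0) → R) ⧸ LinearMap.range (d 0))
    (hμ : μ ∉ (IsLocalRing.maximalIdeal R) •
      (⊤ : Submodule R ((Fin (k 0) → R) ⧸ LinearMap.range (d 0))))
    (hl : modLength R (Submodule.span R {μ}) ≤ (l : WithBot ℕ∞))
    {n : ℕ} (hn : s < n) (y : Fin n → R)
    (hy : ∀ i, y i ∈ IsLocalRing.maximalIdeal R ^ (l * 2 ^ n)) :
    ∃ δ : Fin r → R, (∀ i, δ i ∈ IsLocalRing.maximalIdeal R) ∧ ComplexCertificate r n y δ := by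
  classical
  obtain ⟨e, rfl⟩ := Submodule.mkQ_surjective _ μ
  obtain ⟨φ, hφe, hφ⟩ := exists_functional_of_notMem _ e hμ
  obtain ⟨f, g, hf0, hfg⟩ := exists_chain_of_annihilator n (fun i => Fin (k i) → R) d
    (fun j x => LinearMap.congr_fun (hd j) x) (IsLocalRing.maximalIdeal R ^ l) e
    (fun j a ha v hv => by
      have := smul_eq_zero_of_krullDim_submodule_le l (hH j) a ha
        (Submodule.Quotient.mk ⟨v, LinearMap.mem_ker.2 hv⟩)
      rw [← Submodule.Quotient.mk_smul, Submodule.Quotient.mk_eq_zero] at this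
      exact this)
    (fun a ha => by
      have := smul_eq_zero_of_krullDim_submodule_le l hl a ha
        ⟨_, Submodule.mem_span_singleton_self _⟩
      have := congrArg Subtype.val this
      simp only [Submodule.coe_smul, ZeroMemClass.coe_zero] at this
      rw [← map_smul] at this
      exact (Submodule.Quotient.mk_eq_zero _).1 this)
    y (fun i => by
      refine Ideal.pow_le_pow_right (m := l * 2 ^ i.val) ?_ (hy i) |> fun h => by rwa [← pow_mul]
      exact Nat.mul_le_mul_left _ (Nat.pow_le_pow_right (by norm_num) i.isLt.le))
  let π : ∀ i, (Fin r → R) →ₗ[R] (Fin (k i) → R) := fun i =>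
    LinearMap.funLeft R R (Fin.castLE (hk i))
  have hπ : ∀ i, Function.Surjective (π i) := fun i =>
    LinearMap.funLeft_surjective_of_injective _ _ _ (Fin.castLE_injective _)
  choose ι hι using fun i => Module.projective_lifting_property (π i) LinearMap.id (hπ i)
  have hπι : ∀ i x, π i (ι i x) = x := fun i x => LinearMap.congr_fun (hι i) x
  let D : ℕ → ((Fin r → R) →ₗ[R] (Fin r → R)) := fun i => ι i ∘ₗ d i ∘ₗ π (i + 1)
  have hD : ∀ i x, D i x = ι i (d i (π (i + 1) x)) := fun i x => rfl
  have hw : ∀ x, (fun a => φ (π 0 (Pi.single a 1))) ⬝ᵥ x = φ (π 0 x) := by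
    intro x
    conv_rhs => rw [pi_eq_sum_univ' x, map_sum, map_sum]
    simp only [map_smul, smul_eq_mul, dotProduct]
    exact Finset.sum_congr rfl fun i _ => mul_comm _ _
  refine ⟨(fun a => φ (π 0 (Pi.single a 1))) ᵥ* LinearMap.toMatrix' (D 0), fun c => ?_,
    fun j => LinearMap.toMatrix' (D j), fun j => ι j (f j), fun j i => ι j (g j i),
    fun a => φ (π 0 (Pi.single a 1)), fun j => ?_, ?_, fun j => ?_, ?_, rfl⟩
  · have : ((fun a => φ (π 0 (Pi.single a 1))) ᵥ* LinearMap.toMatrix' (D 0)) c =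
        φ (d 0 (π 1 (Pi.single c 1))) := by
      rw [← hπι 0 (d 0 _), ← hw]
      simp only [Matrix.vecMul]
      congr 1
    rw [this]
    exact hφ _ ⟨_, rfl⟩
  · rw [← LinearMap.toMatrix'_comp]
    have : D j ∘ₗ D (j + 1) = 0 := by
      refine LinearMap.ext fun x => ?_
      rw [LinearMap.comp_apply, hD, hD, hπι]
      have := LinearMap.congr_fun (hd j) (π (j + 1 + 1) x)
      rw [LinearMap.comp_apply] at this
      rw [this]
      simp
    rw [this, map_zero]
  · have : f n = 0 := by
      have : IsEmpty (Fin (k n)) := by rw [hks n hn]; infer_instance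
      exact Subsingleton.elim _ _
    simp [this]
  · rw [LinearMap.toMatrix'_mulVec, hD, hπι, hfg j]
    simp
  · rw [hw, hπι, hf0, hφe]

end

section

open Filter IsLocalRing

variable (R : ℕ → Type u) [∀ n, CommRing (R n)] [∀ n, IsLocalRing (R n)]

/-- The ideal of sequences that lie, for almost all indices, in any given power of the maximal
ideals. -/
def cataIdeal : Ideal (∀ n, R n) where
  carrier := {f | ∀ t, ∀ᶠ n in (hyperfilter ℕ : Filter ℕ), f n ∈ maximalIdeal (R n) ^ t}
  add_mem' hf hg t := by
    filter_upwards [hf t, hg t] with n h1 h2 using add_mem h1 h2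
  zero_mem' t := Eventually.of_forall fun n => zero_mem _
  smul_mem' c f hf t := by
    filter_upwards [hf t] with n h1 using Ideal.mul_mem_left _ _ h1

/-- The cataproduct of a sequence of local rings: the maximal Hausdorff quotient of their
ultraproduct. -/
abbrev Cataproduct : Type u := (∀ n, R n) ⧸ cataIdeal R

variable {R}

theorem mem_cataIdeal {f : ∀ n, R n} :
    f ∈ cataIdeal R ↔ ∀ t, ∀ᶠ n in (hyperfilter ℕ : Filter ℕ), f n ∈ maximalIdeal (R n) ^ t :=
  Iff.rfl

namespace Cataproduct

theorem mk_eq_mk_of_eventually {f g : ∀ n, R n}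
    (h : ∀ᶠ n in (hyperfilter ℕ : Filter ℕ), f n = g n) :
    (Ideal.Quotient.mk (cataIdeal R) f) = Ideal.Quotient.mk _ g := by
  rw [Ideal.Quotient.eq]
  intro t
  filter_upwards [h] with n hn
  simp [hn]

theorem isUnit_mk_iff {f : ∀ n, R n} : IsUnit (Ideal.Quotient.mk (cataIdeal R) f) ↔
    ∀ᶠ n in (hyperfilter ℕ : Filter ℕ), IsUnit (f n) := by
  constructor
  · intro h
    obtain ⟨b, hb⟩ := isUnit_iff_exists_inv.1 h
    obtain ⟨g, rfl⟩ := Ideal.Quotient.mk_surjective b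
    rw [← map_mul, ← map_one (Ideal.Quotient.mk _), Ideal.Quotient.eq] at hb
    filter_upwards [mem_cataIdeal.1 hb 1] with n hn
    rw [pow_one] at hn
    by_contra hcon
    have h1 : f n ∈ maximalIdeal (R n) := hcon
    have h2 := sub_mem (Ideal.mul_mem_right (g n) _ h1) hn
    simp only [Pi.sub_apply, Pi.mul_apply, Pi.one_apply, sub_sub_cancel] at h2
    exact (Ideal.ne_top_iff_one _).1 (maximalIdeal.isMaximal (R n)).ne_top h2
  · intro h
    classical
    refine isUnit_iff_exists_inv.2
      ⟨Ideal.Quotient.mk _ fun n => if h : IsUnit (f n) then ↑h.unit⁻¹ else 0, ?_⟩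
    rw [← map_mul, ← map_one (Ideal.Quotient.mk _)]
    refine mk_eq_mk_of_eventually ?_
    filter_upwards [h] with n hn
    simp [hn]

theorem eventually_isUnit_or {f : ∀ n, R n}
    (h : ¬ IsUnit (Ideal.Quotient.mk (cataIdeal R) f)) :
    ∀ᶠ n in (hyperfilter ℕ : Filter ℕ), f n ∈ maximalIdeal (R n) := by
  rw [isUnit_mk_iff] at h
  exact Ultrafilter.eventually_not.2 h

instance : Nontrivial (Cataproduct R) := by
  refine Ideal.Quotient.nontrivial_iff.2 ((Ideal.ne_top_iff_one _).2 fun h => ?_)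
  obtain ⟨n, hn⟩ := (mem_cataIdeal.1 h 1).exists
  rw [pow_one] at hn
  exact (Ideal.ne_top_iff_one _).1 (maximalIdeal.isMaximal (R n)).ne_top hn

instance : IsLocalRing (Cataproduct R) := by
  refine IsLocalRing.of_nonunits_add fun a b ha hb => ?_
  obtain ⟨f, rfl⟩ := Ideal.Quotient.mk_surjective a
  obtain ⟨g, rfl⟩ := Ideal.Quotient.mk_surjective b
  have h1 := eventually_isUnit_or ha
  have h2 := eventually_isUnit_or hb
  rw [← map_add, mem_nonunits_iff, isUnit_mk_iff]
  intro h3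
  obtain ⟨n, h1, h2, h3⟩ := (h1.and (h2.and h3)).exists
  exact (add_mem h1 h2 : f n + g n ∈ maximalIdeal (R n)) h3

theorem mk_mem_maximalIdeal_iff {f : ∀ n, R n} :
    Ideal.Quotient.mk (cataIdeal R) f ∈ maximalIdeal (Cataproduct R) ↔
      ∀ᶠ n in (hyperfilter ℕ : Filter ℕ), f n ∈ maximalIdeal (R n) := by
  rw [mem_maximalIdeal, mem_nonunits_iff, isUnit_mk_iff, ← Ultrafilter.eventually_not]
  rfl

theorem eventually_mem_of_mk_mem_pow (t : ℕ) {f : ∀ n, R n}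
    (h : Ideal.Quotient.mk (cataIdeal R) f ∈ maximalIdeal (Cataproduct R) ^ t) :
    ∀ᶠ n in (hyperfilter ℕ : Filter ℕ), f n ∈ maximalIdeal (R n) ^ t := by
  suffices H : ∀ x ∈ maximalIdeal (Cataproduct R) ^ t, ∃ g, Ideal.Quotient.mk (cataIdeal R) g = x ∧
      ∀ᶠ n in (hyperfilter ℕ : Filter ℕ), g n ∈ maximalIdeal (R n) ^ t by
    obtain ⟨g, hg, hg'⟩ := H _ h
    rw [Ideal.Quotient.eq] at hg
    filter_upwards [hg', mem_cataIdeal.1 hg t] with n h1 h2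
    have := sub_mem h1 h2
    simpa using this
  clear h f
  induction t with
  | zero =>
    intro x _
    obtain ⟨f, rfl⟩ := Ideal.Quotient.mk_surjective x
    exact ⟨f, rfl, by simp⟩
  | succ t ih =>
    intro x hx
    rw [pow_succ'] at hx
    refine Submodule.mul_induction_on hx (fun a ha b hb => ?_) ?_
    · obtain ⟨f, rfl⟩ := Ideal.Quotient.mk_surjective a
      obtain ⟨g, rfl, hg⟩ := ih b hb
      refine ⟨f * g, map_mul _ _ _, ?_⟩
      filter_upwards [mk_mem_maximalIdeal_iff.1 ha, hg] with n h1 h2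
      rw [pow_succ']
      exact Ideal.mul_mem_mul h1 h2
    · rintro _ _ ⟨f, rfl, hf⟩ ⟨g, rfl, hg⟩
      refine ⟨f + g, map_add _ _ _, ?_⟩
      filter_upwards [hf, hg] with n h1 h2 using add_mem h1 h2

theorem mk_mem_pow_iff {m : ℕ} (x : ∀ n, Fin m → R n)
    (hx : ∀ n, Ideal.span (Set.range (x n)) = maximalIdeal (R n)) (t : ℕ) {f : ∀ n, R n} :
    Ideal.Quotient.mk (cataIdeal R) f ∈ maximalIdeal (Cataproduct R) ^ t ↔
    ∀ᶠ n in (hyperfilter ℕ : Filter ℕ), f n ∈ maximalIdeal (R n) ^ t := by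
  refine ⟨eventually_mem_of_mk_mem_pow t, fun h => ?_⟩
  induction t generalizing f with
  | zero => simp
  | succ t ih =>
    have h1 : ∀ n, ∃ g : Fin m → R n, f n ∈ maximalIdeal (R n) ^ (t + 1) →
        (∀ i, g i ∈ maximalIdeal (R n) ^ t) ∧ f n = ∑ i, x n i * g i := by
      intro n
      by_cases hn : f n ∈ maximalIdeal (R n) ^ (t + 1)
      · have hn' := hn
        rw [pow_succ', ← hx, mul_comm, ← smul_eq_mul, Submodule.mem_ideal_smul_span_iff_exists_sum]
          at hn'
        obtain ⟨a, ha, hsum⟩ := hn'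
        refine ⟨a, fun _ => ⟨fun i => by simpa [hx] using ha i, ?_⟩⟩
        rw [← hsum, Finsupp.sum_fintype _ _ (by simp)]
        exact Finset.sum_congr rfl fun i _ => mul_comm _ _
      · exact ⟨0, fun h => absurd h hn⟩
    choose g hg using h1
    have h2 : Ideal.Quotient.mk (cataIdeal R) f =
        ∑ i, Ideal.Quotient.mk (cataIdeal R) (fun n => x n i) *
          Ideal.Quotient.mk (cataIdeal R) (fun n => g n i) := by
      simp only [← map_mul, ← map_sum]
      refine mk_eq_mk_of_eventually ?_
      filter_upwards [h] with n hn
      simpa using (hg n hn).2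
    rw [h2, pow_succ']
    refine Ideal.sum_mem _ fun i _ => Ideal.mul_mem_mul ?_ (ih ?_)
    · refine mk_mem_maximalIdeal_iff.2 (Eventually.of_forall fun n => ?_)
      rw [← hx]
      exact Ideal.subset_span ⟨i, rfl⟩
    · filter_upwards [h] with n hn using (hg n hn).1 i

theorem isAdicComplete {m : ℕ} (x : ∀ n, Fin m → R n)
    (hx : ∀ n, Ideal.span (Set.range (x n)) = maximalIdeal (R n)) :
    IsAdicComplete (maximalIdeal (Cataproduct R)) (Cataproduct R) where
  haus' := by
    intro a ha
    obtain ⟨f, rfl⟩ := Ideal.Quotient.mk_surjective a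
    rw [Ideal.Quotient.eq_zero_iff_mem]
    intro t
    rw [← mk_mem_pow_iff x hx]
    simpa [SModEq.zero] using ha t
  prec' := by
    classical
    intro a ha
    choose f hf using fun t => Ideal.Quotient.mk_surjective (a t)
    have h1 : ∀ t, ∀ᶠ n in (hyperfilter ℕ : Filter ℕ),
        f t n - f (t + 1) n ∈ maximalIdeal (R n) ^ t := by
      intro t
      refine eventually_mem_of_mk_mem_pow t (f := f t - f (t + 1)) ?_
      have := ha (Nat.le_succ t)
      rw [SModEq.sub_mem] at this
      simpa [hf] using this
    let T : ℕ → ℕ := fun n =>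
      Nat.findGreatest (fun T => ∀ s < T, f s n - f (s + 1) n ∈ maximalIdeal (R n) ^ s) n
    refine ⟨Ideal.Quotient.mk _ fun n => f (T n) n, fun t => ?_⟩
    rw [SModEq.sub_mem, ← hf, ← map_sub]
    suffices H : ∀ᶠ n in (hyperfilter ℕ : Filter ℕ),
        (f t - fun n => f (T n) n) n ∈ maximalIdeal (R n) ^ t by
      have := (mk_mem_pow_iff x hx t).2 H
      simpa using this
    have h2 : ∀ᶠ n in (hyperfilter ℕ : Filter ℕ), t ≤ n := by
      apply hyperfilter_le_cofinite
      rw [Nat.cofinite_eq_atTop]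
      exact mem_atTop t
    have h3 : ∀ᶠ n in (hyperfilter ℕ : Filter ℕ), ∀ s ∈ Finset.range t,
        f s n - f (s + 1) n ∈ maximalIdeal (R n) ^ s :=
      (Filter.eventually_all_finset _).2 fun s _ => h1 s
    filter_upwards [h2, h3] with n hn hs
    have h4 : t ≤ T n := Nat.le_findGreatest hn fun s hst => hs s (Finset.mem_range.2 hst)
    have h5 : ∀ s < T n, f s n - f (s + 1) n ∈ maximalIdeal (R n) ^ s :=
      Nat.findGreatest_spec (P := fun T => ∀ s < T, f s n - f (s + 1) n ∈ maximalIdeal (R n) ^ s)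
        (Nat.zero_le n) (by simp)
    have h6 : ∀ u, t + u ≤ T n → f t n - f (t + u) n ∈ maximalIdeal (R n) ^ t := by
      intro u
      induction u with
      | zero => simp
      | succ u ih =>
        intro hu
        have := add_mem (ih (by omega)) (Ideal.pow_le_pow_right (by omega : t ≤ t + u)
          (h5 (t + u) (by omega)))
        simpa [add_assoc] using this
    have := h6 (T n - t) (by omega)
    rwa [Nat.add_sub_cancel' h4] at this

theorem isUnit_natCast (p : ℕ → ℕ) (hp : ∀ n, n ≤ p n)
    (hchar : ∀ n, CharP (ResidueField (R n)) (p n))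
    (N : ℕ) (hN : N ≠ 0) : IsUnit (N : Cataproduct R) := by
  have : (N : Cataproduct R) = Ideal.Quotient.mk (cataIdeal R) (fun n => (N : R n)) := by
    rw [← map_natCast (Ideal.Quotient.mk (cataIdeal R))]
    rfl
  rw [this, isUnit_mk_iff]
  have h2 : ∀ᶠ n in (hyperfilter ℕ : Filter ℕ), N + 1 ≤ n := by
    apply hyperfilter_le_cofinite
    rw [Nat.cofinite_eq_atTop]
    exact mem_atTop _
  filter_upwards [h2] with n hn
  rw [← residue_ne_zero_iff_isUnit, map_natCast]
  intro h
  have := hchar n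
  rw [CharP.cast_eq_zero_iff _ (p n)] at h
  have := Nat.le_of_dvd (Nat.pos_of_ne_zero hN) h
  have := hp n
  omega

end Cataproduct

end

section

open IsLocalRing

theorem exists_coefficientField {S : Type*} [CommRing S] [IsLocalRing S]
    [IsAdicComplete (maximalIdeal S) S] (hN : ∀ N : ℕ, N ≠ 0 → IsUnit (N : S)) :
    ∃ σ : ResidueField S →+* S, ∀ a, residue S (σ a) = a := by
  have hchar : CharZero (ResidueField S) := by
    refine charZero_of_inj_zero fun N hN0 => ?_
    by_contra hne
    have := (hN N hne).map (residue S)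
    rw [map_natCast, hN0] at this
    exact not_isUnit_zero this
  let f : ℚ →+* S := by
    refine IsLocalization.lift (M := nonZeroDivisors ℤ) (g := Int.castRingHom S) fun y => ?_
    have hy : (y : ℤ) ≠ 0 := nonZeroDivisors.ne_zero y.2
    obtain h | h := Int.natAbs_eq (y : ℤ)
    · rw [h]; simpa using hN _ (Int.natAbs_ne_zero.2 hy)
    · rw [h]; simpa using (hN _ (Int.natAbs_ne_zero.2 hy)).neg
  let _ : Algebra ℚ S := f.toAlgebra
  have : Algebra.FormallySmooth ℚ (ResidueField S) := by
    obtain ⟨ι, v, hv⟩ := exists_isTranscendenceBasis' ℚ (ResidueField S)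
    have h2 := hv.isAlgebraic_field
    exact Algebra.FormallySmooth.of_algebraicIndependent_of_isSeparable hv.1
  obtain ⟨g, hg⟩ := Algebra.FormallySmooth.exists_mkₐ_comp_eq_of_isAdicComplete
    (I := maximalIdeal S) (R := ℚ) (A := ResidueField S)
    (RingHom.toRatAlgHom (RingHom.id (ResidueField S)))
  exact ⟨g.toRingHom, fun a => DFunLike.congr_fun hg a⟩

theorem exists_mvPowerSeries_ringHom {S k : Type*} [CommRing S] [Field k] (I : Ideal S)
    [IsAdicComplete I S] (σ : k →+* S) {d : ℕ} (y : Fin d → S) (hy : ∀ i, y i ∈ I) :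
    ∃ ψ : MvPowerSeries (Fin d) k →+* S, (∀ a, ψ (MvPowerSeries.C a) = σ a) ∧
      ∀ i, ψ (MvPowerSeries.X i) = y i := by
  let e : MvPolynomial (Fin d) k →+* S := MvPolynomial.eval₂Hom σ y
  have he : ∀ n, MvPolynomial.idealOfVars (Fin d) k ^ n ≤ (I ^ n).comap e := by
    intro n
    refine le_trans (Ideal.pow_right_mono ?_ n) (Ideal.le_comap_pow e n)
    rw [MvPolynomial.idealOfVars, Ideal.span_le]
    rintro _ ⟨i, rfl⟩
    simpa [e] using hy i
  let F : ∀ n, MvPowerSeries (Fin d) k →+* S ⧸ I ^ n := fun n =>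
    (Ideal.quotientMap (I ^ n) e (he n)).comp
      (MvPowerSeries.truncTotalAlgHom (Fin d) k n).toRingHom
  have hF : ∀ n x, F n x = Ideal.Quotient.mk _ (e (MvPowerSeries.truncTotal n x)) :=
    fun n x => rfl
  have hF' : ∀ {a b : ℕ} (h : a ≤ b), (Ideal.Quotient.factorPow I h).comp (F b) = F a := by
    intro a b h
    ext x
    rw [RingHom.comp_apply, hF, hF]
    erw [Ideal.Quotient.factor_mk]
    rw [Ideal.Quotient.eq, ← map_sub]
    exact he _ (MvPowerSeries.truncTotal_sub_truncTotal_mem_pow_idealOfVars h le_rfl x)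
  have key : ∀ (x : MvPolynomial (Fin d) k),
      IsAdicComplete.liftRingHom I F hF' (x : MvPowerSeries (Fin d) k) = e x := by
    intro x
    rw [IsHausdorff.eq_iff_smodEq (I := I)]
    intro n
    rw [SModEq.sub_mem, smul_eq_mul, Ideal.mul_top, ← Ideal.Quotient.eq,
      IsAdicComplete.mk_liftRingHom, hF, Ideal.Quotient.eq, ← map_sub]
    refine he _ ((MvPolynomial.mem_pow_idealOfVars_iff' ..).2 fun w hw => ?_)
    rw [MvPolynomial.coeff_sub, MvPowerSeries.coeff_truncTotal _ hw, MvPolynomial.coeff_coe,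
      sub_self]
  refine ⟨IsAdicComplete.liftRingHom I F hF', fun a => ?_, fun i => ?_⟩
  · rw [← MvPolynomial.coe_C, key]; simp [e]
  · rw [← MvPolynomial.coe_X, key]; simp [e]

theorem Module.finite_of_isPrecomplete {A S : Type*} [CommRing A] [CommRing S] [IsLocalRing S]
    [Algebra A S] (I : Ideal A) [IsPrecomplete I A] [IsHausdorff (maximalIdeal S) S]
    (hI : I.map (algebraMap A S) ≤ maximalIdeal S)
    (hres : ∀ s : S, ∃ a : A, s - algebraMap A S a ∈ maximalIdeal S)
    (hfg : (maximalIdeal S).FG) (n : ℕ) (hn : maximalIdeal S ^ n ≤ I.map (algebraMap A S)) :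
    Module.Finite A S := by
  classical
  have h1 : ∀ n : ℕ, ∃ T : Finset S, ∀ s : S, ∃ b ∈ Submodule.span A (T : Set S),
      s - b ∈ maximalIdeal S ^ n := by
    intro n
    induction n with
    | zero => exact ⟨∅, fun s => ⟨0, zero_mem _, by simp⟩⟩
    | succ n ih =>
      obtain ⟨T, hT⟩ := ih
      obtain ⟨G, hG⟩ := hfg.pow (n := n)
      refine ⟨T ∪ G, fun s => ?_⟩
      obtain ⟨b, hb, hs⟩ := hT s
      have h2 : ∀ z ∈ Ideal.span (G : Set S), ∃ b ∈ Submodule.span A (G : Set S),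
          z - b ∈ maximalIdeal S ^ (n + 1) := by
        intro z hz
        induction hz using Submodule.span_induction with
        | mem x hx => exact ⟨x, Submodule.subset_span hx, by simp⟩
        | zero => exact ⟨0, zero_mem _, by simp⟩
        | add u v _ _ hu hv =>
          obtain ⟨a, ha, hu⟩ := hu
          obtain ⟨c, hc, hv⟩ := hv
          exact ⟨a + c, add_mem ha hc, by convert add_mem hu hv using 1; ring⟩
        | smul t x hx hu =>
          obtain ⟨a, ha, hu⟩ := hu
          obtain ⟨c, hc⟩ := hres t
          refine ⟨c • a, Submodule.smul_mem _ _ ha, ?_⟩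
          have hx' : a ∈ maximalIdeal S ^ n := by
            have hx' : x ∈ maximalIdeal S ^ n := hG ▸ hx
            have := sub_mem hx' (Ideal.pow_le_pow_right n.le_succ hu)
            simpa using this
          have e1 := Ideal.mul_mem_left _ t hu
          have e2 := Ideal.mul_mem_mul hx' hc
          rw [← pow_succ] at e2
          convert add_mem e1 e2 using 1
          rw [smul_eq_mul, Algebra.smul_def c a]; ring
      obtain ⟨c, hc, hz⟩ := h2 (s - b) (hG ▸ hs)
      refine ⟨b + c, add_mem (Submodule.span_mono (by simp) hb)
        (Submodule.span_mono (by simp) hc), by rwa [← sub_sub]⟩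
  obtain ⟨T, hT⟩ := h1 n
  have hpre : IsPrecomplete I (T → A) := by
    refine ⟨fun f hf => ?_⟩
    have hc : ∀ i : T, ∃ L : A, ∀ n, f n i ≡ L [SMOD (I ^ n • ⊤ : Submodule A A)] := by
      intro i
      refine IsPrecomplete.prec inferInstance fun {a b} hab => ?_
      have := (hf hab).map (LinearMap.proj i : (T → A) →ₗ[A] A)
      refine this.mono ?_
      rw [Submodule.map_smul'']
      exact Submodule.smul_mono le_rfl le_top
    choose L hL using hc
    refine ⟨L, fun n => ?_⟩
    rw [SModEq.sub_mem]
    have : f n - L = ∑ i, (f n i - L i) • (Pi.single i 1 : T → A) := by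
      ext j
      simp [Finset.sum_apply, Pi.single_apply]
    rw [this]
    refine Submodule.sum_mem _ fun i _ => Submodule.smul_mem_smul ?_ trivial
    have := hL i n
    rwa [SModEq.sub_mem, smul_eq_mul, Ideal.mul_top] at this
  have hmap : ∀ n : ℕ, (I ^ n • ⊤ : Submodule A S) =
      ((I ^ n).map (algebraMap A S)).restrictScalars A := fun n => Ideal.smul_top_eq_map _
  have hhaus : IsHausdorff I S := by
    refine ⟨fun x hx => ?_⟩
    refine IsHausdorff.haus (I := maximalIdeal S) inferInstance x fun n => ?_
    have := hx n
    rw [SModEq.zero] at this ⊢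
    rw [hmap, Submodule.restrictScalars_mem, Ideal.map_pow] at this
    rw [smul_eq_mul, Ideal.mul_top]
    exact Ideal.pow_right_mono hI n this
  let F : (T → A) →ₗ[A] S := Fintype.linearCombination A (fun t : T => (t : S))
  have hF : Function.Surjective F := by
    refine surjective_of_mkQ_comp_surjective (I := I) fun x => ?_
    obtain ⟨s, rfl⟩ := Submodule.mkQ_surjective _ x
    obtain ⟨b, hb, hs⟩ := hT s
    have : b ∈ LinearMap.range F := by
      rw [Fintype.range_linearCombination]; simpa using hb
    obtain ⟨c, rfl⟩ := this
    refine ⟨c, ?_⟩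
    rw [LinearMap.comp_apply, Submodule.mkQ_apply, Submodule.mkQ_apply, eq_comm,
      Submodule.Quotient.eq]
    have e := hmap 1
    rw [pow_one] at e
    rw [e]
    exact hn hs
  exact Module.Finite.of_surjective F hF

theorem MvPowerSeries.maximalIdeal_eq_span {k : Type*} [Field k] {d : ℕ} :
    maximalIdeal (MvPowerSeries (Fin d) k) =
      Ideal.span (Set.range (MvPowerSeries.X : Fin d → MvPowerSeries (Fin d) k)) := by
  apply le_antisymm
  · intro x hx
    have hx : MvPowerSeries.constantCoeff x = 0 := by
      by_contra h
      exact hx (MvPowerSeries.isUnit_iff_constantCoeff.2 (isUnit_iff_ne_zero.2 h))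
    obtain ⟨v, hv⟩ := MvPowerSeries.exists_eq_sum_X_pow_mul 1 d x (fun e he => by
      have : e = 0 := by ext i; simpa using he i i.2
      rw [this]; simpa using hx)
    rw [hv]
    refine Ideal.sum_mem _ fun i _ => Ideal.mul_mem_right _ _ ?_
    rw [pow_one]
    exact Ideal.subset_span ⟨i, rfl⟩
  · rw [Ideal.span_le]
    rintro _ ⟨i, rfl⟩
    intro h
    have := MvPowerSeries.isUnit_iff_constantCoeff.1 h
    simp at this

theorem MvPowerSeries.exists_finset_pow_le_of_ne_zero {k : Type*} [Field k] {d : ℕ}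
    (g : MvPowerSeries (Fin d) k) (hg : g ≠ 0) (hgu : ¬ IsUnit g) :
    ∃ (s : Finset (MvPowerSeries (Fin d) k)) (N : ℕ), s.card < d ∧
      (∀ x ∈ s, x ∈ maximalIdeal (MvPowerSeries (Fin d) k)) ∧
      maximalIdeal (MvPowerSeries (Fin d) k) ^ N ≤
        Ideal.span (s : Set (MvPowerSeries (Fin d) k)) ⊔ Ideal.span {g} := by
  classical
  have := MvPowerSeries.isNoetherianRing (σ := Fin d) (S := k)
  let A := MvPowerSeries (Fin d) k
  have hne : Ideal.span {g} ≠ ⊤ := by rwa [Ne, Ideal.span_singleton_eq_top]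
  have : Nontrivial (A ⧸ Ideal.span {g}) := Ideal.Quotient.nontrivial_iff.2 hne
  let π := Ideal.Quotient.mk (Ideal.span {g})
  have hπ : Function.Surjective π := Ideal.Quotient.mk_surjective
  have : IsLocalRing (A ⧸ Ideal.span {g}) := IsLocalRing.of_surjective' π hπ
  have hloc : IsLocalHom π := .of_surjective π hπ
  have hdim : ringKrullDim A ≤ d := by
    refine (ringKrullDim_le_spanFinrank_maximalIdeal A).trans ?_
    rw [MvPowerSeries.maximalIdeal_eq_span]
    have := Submodule.spanFinrank_span_le_ncard_of_finite (R := A) (M := A)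
      (Set.finite_range (MvPowerSeries.X : Fin d → MvPowerSeries (Fin d) k))
    have h2 := Set.ncard_image_le (f := (MvPowerSeries.X : Fin d → MvPowerSeries (Fin d) k))
      (s := Set.univ) Set.finite_univ
    rw [Set.image_univ, Set.ncard_univ, Nat.card_fin] at h2
    exact_mod_cast this.trans h2
  have hdim2 := (ringKrullDim_quotient_succ_le_of_nonZeroDivisor
    (mem_nonZeroDivisors_of_ne_zero hg)).trans hdim
  obtain ⟨s, hs, hcard⟩ := Ideal.exists_finset_card_eq_height_of_isNoetherianRing
    (maximalIdeal (A ⧸ Ideal.span {g}))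
  rw [← IsLocalRing.maximalIdeal_height_eq_ringKrullDim, ← hcard] at hdim2
  have hlt : s.card < d := by
    have : ((s.card + 1 : ℕ) : WithBot ℕ∞) ≤ (d : ℕ) := by exact_mod_cast hdim2
    exact_mod_cast this
  have hrad : maximalIdeal (A ⧸ Ideal.span {g}) ≤ (Ideal.span (s : Set _)).radical := by
    rw [Ideal.radical_eq_sInf]
    refine le_sInf fun J hJ => ?_
    have := hJ.2
    exact hs.2 ⟨hJ.2, hJ.1⟩ (le_maximalIdeal hJ.2.ne_top)
  obtain ⟨N, hN⟩ := Ideal.exists_pow_le_of_le_radical_of_fg hrad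
    (IsNoetherian.noetherian _)
  choose f hf using hπ
  refine ⟨s.image f, N, lt_of_le_of_lt Finset.card_image_le hlt, ?_, ?_⟩
  · intro x hx
    obtain ⟨z, hz, rfl⟩ := Finset.mem_image.1 hx
    have hz' : z ∈ maximalIdeal (A ⧸ Ideal.span {g}) := hs.1.2 (Ideal.subset_span hz)
    intro hu
    exact hz' (by simpa [hf] using hu.map π)
  · have h1 : (maximalIdeal A).map π ≤ maximalIdeal (A ⧸ Ideal.span {g}) :=
      (Ideal.map_le_iff_le_comap.2 fun x hx hu => hx (isUnit_of_map_unit π x hu))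
    have h2 : (maximalIdeal A ^ N).map π ≤ Ideal.span (s : Set _) := by
      rw [Ideal.map_pow]
      exact (Ideal.pow_right_mono h1 N).trans hN
    have h3 : Ideal.span (s : Set (A ⧸ Ideal.span {g})) =
        (Ideal.span (s.image f : Set A)).map π := by
      rw [Ideal.map_span, Finset.coe_image, Set.image_image]
      simp only [hf, Set.image_id']
      rfl
    rw [h3, Ideal.map_le_iff_le_comap, Ideal.comap_map_of_surjective' _
      Ideal.Quotient.mk_surjective, Ideal.mk_ker] at h2
    exact h2

theorem exists_noetherNormalization {S : Type*} [CommRing S] [IsLocalRing S]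
    [IsAdicComplete (maximalIdeal S) S] (hN : ∀ N : ℕ, N ≠ 0 → IsUnit (N : S))
    (hfg : (maximalIdeal S).FG) {d : ℕ} (y : Fin d → S) (hy : ∀ i, y i ∈ maximalIdeal S) {n : ℕ}
    (hn : maximalIdeal S ^ n ≤ Ideal.span (Set.range y))
    (hmin : ∀ d' < d, ∀ y' : Fin d' → S, (∀ i, y' i ∈ maximalIdeal S) →
      ∀ n, ¬ maximalIdeal S ^ n ≤ Ideal.span (Set.range y')) :
    ∃ ψ : MvPowerSeries (Fin d) (ResidueField S) →+* S,
      (∀ i, ψ (MvPowerSeries.X i) = y i) ∧ Function.Injective ψ ∧ ψ.IsIntegral := by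
  obtain ⟨σ, hσ⟩ := exists_coefficientField hN
  obtain ⟨ψ, hC, hX⟩ := exists_mvPowerSeries_ringHom (maximalIdeal S) σ y hy
  refine ⟨ψ, hX, ?_, ?_⟩
  · rw [injective_iff_map_eq_zero]
    intro g hg
    by_contra hg0
    have hgu : ¬ IsUnit g := fun h => not_isUnit_zero (hg ▸ h.map ψ)
    obtain ⟨s, N, hs, hsm, hsN⟩ := MvPowerSeries.exists_finset_pow_le_of_ne_zero g hg0 hgu
    refine hmin s.card hs (fun i => ψ (s.equivFin.symm i)) ?_ (n * N) ?_
    · intro i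
      have h1 := hsm _ (s.equivFin.symm i).2
      rw [MvPowerSeries.maximalIdeal_eq_span] at h1
      have h2 := Ideal.mem_map_of_mem ψ h1
      refine (?_ : Ideal.map ψ _ ≤ _) h2
      rw [Ideal.map_span, Ideal.span_le]
      rintro _ ⟨_, ⟨j, rfl⟩, rfl⟩
      rw [hX]; exact hy j
    · have h1 : Ideal.span (Set.range y) =
          (maximalIdeal (MvPowerSeries (Fin d) (ResidueField S))).map ψ := by
        rw [MvPowerSeries.maximalIdeal_eq_span, Ideal.map_span, ← Set.range_comp]
        congr 2
        ext i; simp [hX]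
      rw [pow_mul]
      refine (Ideal.pow_right_mono hn N).trans ?_
      rw [h1, ← Ideal.map_pow]
      refine (Ideal.map_mono hsN).trans ?_
      rw [Ideal.map_sup, Ideal.map_span, Ideal.map_span, Set.image_singleton, hg,
        Ideal.span_singleton_zero, sup_bot_eq, Ideal.span_le]
      rintro _ ⟨x, hx, rfl⟩
      exact Ideal.subset_span ⟨s.equivFin ⟨x, hx⟩, by simp⟩
  · let _ : Algebra (MvPowerSeries (Fin d) (ResidueField S)) S := ψ.toAlgebra
    have hmap : (Ideal.span (Set.range MvPowerSeries.X)).map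
        (algebraMap (MvPowerSeries (Fin d) (ResidueField S)) S) = Ideal.span (Set.range y) := by
      rw [Ideal.map_span, ← Set.range_comp]
      congr 2
      ext i; exact hX i
    have := Module.finite_of_isPrecomplete (A := MvPowerSeries (Fin d) (ResidueField S)) (S := S)
      (Ideal.span (Set.range MvPowerSeries.X))
      (by rw [hmap, Ideal.span_le]; rintro _ ⟨i, rfl⟩; exact hy i)
      (fun s => ⟨MvPowerSeries.C (residue S s), by
        change s - ψ _ ∈ _
        rw [hC, ← residue_eq_zero_iff, map_sub, hσ, sub_self]⟩) hfg n (hmap ▸ hn)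
    exact fun x => IsIntegral.of_finite _ x

end

section

open Filter IsLocalRing
open scoped Matrix Pointwise

namespace Cataproduct

variable {R : ℕ → Type u} [∀ n, CommRing (R n)] [∀ n, IsLocalRing (R n)]

theorem complexCertificate {r d : ℕ} (y : Fin d → ∀ n, R n) (δ : Fin r → ∀ n, R n)
    (h : ∀ᶠ n in (hyperfilter ℕ : Filter ℕ),
      ComplexCertificate r d (fun i => y i n) (fun i => δ i n)) :
    ComplexCertificate r d (fun i => Ideal.Quotient.mk (cataIdeal R) (y i))
      (fun i => Ideal.Quotient.mk (cataIdeal R) (δ i)) := by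
  classical
  have h' : ∀ n, ∃ (D : ℕ → Matrix (Fin r) (Fin r) (R n)) (f : ℕ → Fin r → R n)
      (g : ℕ → Fin d → Fin r → R n) (w : Fin r → R n),
      ComplexCertificate r d (fun i => y i n) (fun i => δ i n) →
      (∀ j, D j * D (j + 1) = 0) ∧ f d = 0 ∧
      (∀ j : Fin d, D j *ᵥ f (j + 1) = y j n • f j + ∑ i with i.val < j.val, y i n • g j i) ∧
      w ⬝ᵥ f 0 = 1 ∧ w ᵥ* D 0 = fun i => δ i n := by
    intro n
    by_cases hn : ComplexCertificate r d (fun i => y i n) (fun i => δ i n)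
    · obtain ⟨D, f, g, w, H⟩ := hn
      exact ⟨D, f, g, w, fun _ => H⟩
    · exact ⟨0, 0, 0, 0, fun h => absurd h hn⟩
  choose D f g w H using h'
  let π := Ideal.Quotient.mk (cataIdeal R)
  refine ⟨fun j => Matrix.of fun a b => π fun n => D n j a b, fun j a => π fun n => f n j a,
    fun j i a => π fun n => g n j i a, fun a => π fun n => w n a, fun j => ?_, ?_, fun j => ?_,
    ?_, ?_⟩
  · ext a b
    simp only [Matrix.mul_apply, Matrix.of_apply, Matrix.zero_apply, ← map_mul, ← map_sum]
    rw [← map_zero π]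
    refine mk_eq_mk_of_eventually (h.mono fun n hn => ?_)
    have := congrFun (congrFun ((H n hn).1 j) a) b
    simpa [Matrix.mul_apply] using this
  · ext a
    rw [Pi.zero_apply, ← map_zero π]
    exact mk_eq_mk_of_eventually (h.mono fun n hn => congrFun (H n hn).2.1 a)
  · ext a
    simp only [Matrix.mulVec, dotProduct, Matrix.of_apply, Pi.add_apply, Pi.smul_apply,
      Finset.sum_apply, smul_eq_mul, ← map_mul, ← map_sum, ← map_add, π]
    refine mk_eq_mk_of_eventually (h.mono fun n hn => ?_)
    have := congrFun ((H n hn).2.2.1 j) a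
    simpa [Matrix.mulVec, dotProduct] using this
  · simp only [dotProduct, ← map_mul, ← map_sum]
    rw [← map_one π]
    refine mk_eq_mk_of_eventually (h.mono fun n hn => ?_)
    simpa [dotProduct] using (H n hn).2.2.2.1
  · ext a
    simp only [Matrix.vecMul, dotProduct, Matrix.of_apply, ← map_mul, ← map_sum, π]
    refine mk_eq_mk_of_eventually (h.mono fun n hn => ?_)
    simpa [Matrix.vecMul, dotProduct] using congrFun (H n hn).2.2.2.2 a

theorem mk_mem_span_range {d : ℕ} (y : Fin d → ∀ n, R n) (f : ∀ n, R n)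
    (h : ∀ᶠ n in (hyperfilter ℕ : Filter ℕ), f n ∈ Ideal.span (Set.range fun i => y i n)) :
    Ideal.Quotient.mk (cataIdeal R) f ∈
      Ideal.span (Set.range fun i => Ideal.Quotient.mk (cataIdeal R) (y i)) := by
  have h' : ∀ n, ∃ c : Fin d → R n, f n ∈ Ideal.span (Set.range fun i => y i n) →
      ∑ i, c i * y i n = f n := by
    intro n
    by_cases hn : f n ∈ Ideal.span (Set.range fun i => y i n)
    · obtain ⟨c, hc⟩ := Ideal.mem_span_range_iff_exists_fun.1 hn
      exact ⟨c, fun _ => hc⟩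
    · exact ⟨0, fun h => absurd h hn⟩
  choose c hc using h'
  refine Ideal.mem_span_range_iff_exists_fun.2 ⟨fun i => Ideal.Quotient.mk _ fun n => c n i, ?_⟩
  simp only [← map_mul, ← map_sum]
  refine mk_eq_mk_of_eventually (h.mono fun n hn => ?_)
  simpa using hc n hn

theorem eventually_mem_sup_of_mk_mem_span_range {d : ℕ} (y : Fin d → ∀ n, R n) (f : ∀ n, R n)
    (h : Ideal.Quotient.mk (cataIdeal R) f ∈
      Ideal.span (Set.range fun i => Ideal.Quotient.mk (cataIdeal R) (y i))) (t : ℕ) :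
    ∀ᶠ n in (hyperfilter ℕ : Filter ℕ),
      f n ∈ Ideal.span (Set.range fun i => y i n) ⊔ maximalIdeal (R n) ^ t := by
  obtain ⟨c, hc⟩ := Ideal.mem_span_range_iff_exists_fun.1 h
  choose C hC using fun i => Ideal.Quotient.mk_surjective (c i)
  simp only [← hC, ← map_mul, ← map_sum] at hc
  rw [eq_comm, Ideal.Quotient.eq] at hc
  filter_upwards [hc t] with n hn
  have h2 : ∑ i, C i n * y i n ∈ Ideal.span (Set.range fun i => y i n) :=
    Ideal.mem_span_range_iff_exists_fun.2 ⟨fun i => C i n, rfl⟩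
  have := add_mem (show _ ∈ Ideal.span (Set.range fun i => y i n) ⊔ maximalIdeal (R n) ^ t from
    Submodule.mem_sup_left h2) (Submodule.mem_sup_right hn)
  simpa using this

end Cataproduct

theorem ringKrullDim_le_of_pow_le_span {R : Type*} [CommRing R] [IsLocalRing R]
    [IsNoetherianRing R] {d n : ℕ} (y : Fin d → R) (hy : ∀ i, y i ∈ maximalIdeal R)
    (h : maximalIdeal R ^ n ≤ Ideal.span (Set.range y)) : ringKrullDim R ≤ d := by
  rw [← IsLocalRing.maximalIdeal_height_eq_ringKrullDim]
  have hmin : maximalIdeal R ∈ (Ideal.span (Set.range y)).minimalPrimes := by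
    refine ⟨⟨inferInstance, ?_⟩, fun J hJ _ => hJ.1.le_of_pow_le (h.trans hJ.2)⟩
    rw [Ideal.span_le]
    rintro _ ⟨i, rfl⟩
    exact hy i
  have h1 := Ideal.height_le_card_of_mem_minimalPrimes_span (Set.finite_range y) hmin
  have h2 := Set.ncard_image_le (f := y) (s := Set.univ) Set.finite_univ
  rw [Set.image_univ, Set.ncard_univ, Nat.card_fin] at h2
  exact_mod_cast h1.trans (Nat.cast_le.2 h2)

theorem exists_bad_domain {m r l : ℕ} (R : ℕ → Type u) [∀ n, CommRing (R n)]
    [∀ n, IsLocalRing (R n)] [∀ n, IsNoetherianRing (R n)] (p : ℕ → ℕ) (hp : ∀ n, n ≤ p n)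
    (hchar : ∀ n, CharP (ResidueField (R n)) (p n)) (x : ∀ n, Fin m → R n)
    (hx : ∀ n, Ideal.span (Set.range (x n)) = maximalIdeal (R n)) (s : ℕ → ℕ)
    (hs : ∀ n, (s n : WithBot ℕ∞) < ringKrullDim (R n))
    (H : ∀ n D, s n < D → ∀ y : Fin D → R n, (∀ i, y i ∈ maximalIdeal (R n) ^ (l * 2 ^ D)) →
      ∃ δ : Fin r → R n, (∀ i, δ i ∈ maximalIdeal (R n)) ∧ ComplexCertificate r D y δ) :
    ∃ (k B : Type u) (_ : Field k) (_ : CharZero k) (_ : CommRing B) (_ : IsDomain B) (d N n : ℕ)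
      (ψ : MvPowerSeries (Fin d) k →+* B) (δ : Fin r → B), Function.Injective ψ ∧ ψ.IsIntegral ∧
      (∀ i, δ i ^ n ∈ Ideal.span (Set.range fun i => ψ (MvPowerSeries.X i))) ∧
      ComplexCertificate r d (fun i => ψ (MvPowerSeries.X i ^ N)) δ := by
  classical
  have := Cataproduct.isAdicComplete x hx
  let π := Ideal.Quotient.mk (cataIdeal R)
  have hm1 : maximalIdeal (Cataproduct R) =
      Ideal.span (Set.range fun i => π fun n => x n i) := by
    apply le_antisymm
    · intro a ha
      obtain ⟨f, rfl⟩ := Ideal.Quotient.mk_surjective a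
      refine Cataproduct.mk_mem_span_range _ f
        ((Cataproduct.mk_mem_maximalIdeal_iff.1 ha).mono fun n hn => ?_)
      rwa [← hx n] at hn
    · rw [Ideal.span_le]
      rintro _ ⟨i, rfl⟩
      refine Cataproduct.mk_mem_maximalIdeal_iff.2 (Eventually.of_forall fun n => ?_)
      rw [← hx n]
      exact Ideal.subset_span ⟨i, rfl⟩
  have hfg : (maximalIdeal (Cataproduct R)).FG := by
    rw [hm1]
    exact Submodule.fg_span (Set.finite_range _)
  let P : ℕ → Prop := fun d => ∃ y : Fin d → Cataproduct R,
    (∀ i, y i ∈ maximalIdeal (Cataproduct R)) ∧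
    ∃ n, maximalIdeal (Cataproduct R) ^ n ≤ Ideal.span (Set.range y)
  have hP : ∃ d, P d := ⟨m, fun i => π fun n => x n i, fun i => by
    rw [hm1]; exact Ideal.subset_span ⟨i, rfl⟩, 1, by rw [pow_one, hm1]⟩
  obtain ⟨y, hy, n, hn⟩ := Nat.find_spec hP
  have hmin := fun d' (hd' : d' < Nat.find hP) => Nat.find_min hP hd'
  generalize Nat.find hP = d at *
  choose Y hY using fun i => Ideal.Quotient.mk_surjective (y i)
  have hYm : ∀ᶠ κ in (hyperfilter ℕ : Filter ℕ), ∀ i, Y i κ ∈ maximalIdeal (R κ) :=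
    eventually_all.2 fun i => Cataproduct.mk_mem_maximalIdeal_iff.1 (by rw [hY]; exact hy i)
  have hdim : ∀ᶠ κ in (hyperfilter ℕ : Filter ℕ), s κ < d := by
    let X : Set (∀ κ, R κ) := (Set.range fun i κ => x κ i) ^ n
    have hX : X.Finite := by
      have hpow : ∀ t : ℕ, ((Set.range fun i κ => x κ i) ^ t : Set (∀ κ, R κ)).Finite := by
        intro t
        induction t with
        | zero => rw [pow_zero]; exact Set.finite_one
        | succ t ih => rw [pow_succ]; exact ih.mul (Set.finite_range _)
      exact hpow n
    have h1 : ∀ᶠ κ in (hyperfilter ℕ : Filter ℕ), ∀ f ∈ X,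
        f κ ∈ Ideal.span (Set.range fun i => Y i κ) ⊔ maximalIdeal (R κ) ^ (n + 1) := by
      refine (eventually_all_finite hX).2 fun f hf => ?_
      refine Cataproduct.eventually_mem_sup_of_mk_mem_span_range Y f ?_ (n + 1)
      have h2 : π f ∈ maximalIdeal (Cataproduct R) ^ n := by
        refine (Cataproduct.mk_mem_pow_iff x hx n).2 (Eventually.of_forall fun κ => ?_)
        have h3 : f κ ∈ (Pi.evalRingHom R κ) '' X := ⟨f, hf, rfl⟩
        rw [Set.image_pow, ← Set.range_comp] at h3
        rw [← hx, Ideal.span, Submodule.span_pow]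
        exact Submodule.subset_span h3
      have := hn h2
      simp only [hY]
      exact this
    filter_upwards [h1, hYm] with κ hκ hYκ
    have h2 : maximalIdeal (R κ) ^ n ≤
        Ideal.span (Set.range fun i => Y i κ) ⊔ maximalIdeal (R κ) ^ (n + 1) := by
      conv_lhs => rw [← hx, Ideal.span, Submodule.span_pow]
      rw [Submodule.span_le]
      have h4 : (Set.range (x κ)) ^ n = (Pi.evalRingHom R κ) '' X := by
        rw [Set.image_pow, ← Set.range_comp]; rfl
      rw [h4]
      rintro _ ⟨f, hf, rfl⟩
      exact hκ f hf
    have h3 : maximalIdeal (R κ) ^ n ≤ Ideal.span (Set.range fun i => Y i κ) := by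
      refine Submodule.le_of_le_smul_of_le_jacobson_bot (I := maximalIdeal (R κ))
        (IsNoetherian.noetherian _) (IsLocalRing.maximalIdeal_le_jacobson _) ?_
      rwa [smul_eq_mul, ← pow_succ']
    exact_mod_cast (hs κ).trans_le (ringKrullDim_le_of_pow_le_span _ hYκ h3)
  have hδ : ∀ κ, ∃ δ : Fin r → R κ, (s κ < d ∧ ∀ i, Y i κ ∈ maximalIdeal (R κ)) →
      (∀ i, δ i ∈ maximalIdeal (R κ)) ∧
      ComplexCertificate r d (fun i => Y i κ ^ (l * 2 ^ d)) δ := by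
    intro κ
    by_cases h : s κ < d ∧ ∀ i, Y i κ ∈ maximalIdeal (R κ)
    · obtain ⟨δ, hδ⟩ := H κ d h.1 (fun i => Y i κ ^ (l * 2 ^ d))
        fun i => Ideal.pow_mem_pow (h.2 i) _
      exact ⟨δ, fun _ => hδ⟩
    · exact ⟨0, fun h' => absurd h' h⟩
  choose δ hδ using hδ
  have hcert := Cataproduct.complexCertificate (fun i => Y i ^ (l * 2 ^ d)) (fun i κ => δ κ i)
    (by filter_upwards [hdim, hYm] with κ h1 h2 using (hδ κ ⟨h1, h2⟩).2)
  have hδm : ∀ i, π (fun κ => δ κ i) ∈ maximalIdeal (Cataproduct R) := fun i =>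
    Cataproduct.mk_mem_maximalIdeal_iff.2
      (by filter_upwards [hdim, hYm] with κ h1 h2 using (hδ κ ⟨h1, h2⟩).1 i)
  simp only [map_pow, hY] at hcert
  obtain ⟨ψ, hψX, hψ, hψi⟩ := exists_noetherNormalization
    (Cataproduct.isUnit_natCast p hp hchar) hfg y hy hn
    (fun d' hd' y' hy' n hn => hmin d' hd' ⟨y', hy', n, hn⟩)
  have hchar0 : CharZero (ResidueField (Cataproduct R)) := by
    refine charZero_of_inj_zero fun N hN0 => ?_
    by_contra hne
    have := (Cataproduct.isUnit_natCast p hp hchar N hne).map (residue (Cataproduct R))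
    rw [map_natCast, hN0] at this
    exact not_isUnit_zero this
  let _ : Algebra (MvPowerSeries (Fin d) (ResidueField (Cataproduct R))) (Cataproduct R) :=
    ψ.toAlgebra
  have hψint : Algebra.IsIntegral (MvPowerSeries (Fin d) (ResidueField (Cataproduct R)))
    (Cataproduct R) := ⟨hψi⟩
  obtain ⟨Q, -, hQ, hQc⟩ := Ideal.exists_ideal_over_prime_of_isIntegral
    (R := MvPowerSeries (Fin d) (ResidueField (Cataproduct R))) (S := Cataproduct R) ⊥ ⊥
    (((RingHom.injective_iff_ker_eq_bot _).1 hψ).le)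
  refine ⟨ResidueField (Cataproduct R), Cataproduct R ⧸ Q, inferInstance, hchar0, inferInstance,
    inferInstance, d, l * 2 ^ d, n, (Ideal.Quotient.mk Q).comp ψ,
    fun i => Ideal.Quotient.mk Q (π fun κ => δ κ i), ?_, ?_, fun i => ?_, ?_⟩
  · rw [RingHom.injective_iff_ker_eq_bot, ← RingHom.comap_ker, Ideal.mk_ker]
    exact hQc
  · exact hψi.trans _ _ (RingHom.isIntegral_of_surjective _ Ideal.Quotient.mk_surjective)
  · have := Ideal.mem_map_of_mem (Ideal.Quotient.mk Q) (hn (Ideal.pow_mem_pow (hδm i) n))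
    rw [Ideal.map_span, ← Set.range_comp, map_pow] at this
    simp only [RingHom.comp_apply, hψX]
    exact this
  · have := hcert.map (Ideal.Quotient.mk Q)
    simp only [RingHom.comp_apply, map_pow, hψX] at this ⊢
    exact this

end

section

open IsLocalRing Polynomial

/-- A form of Hensel's lemma for polynomials that need not be monic. -/
theorem HenselianLocalRing.exists_one_add_add_eq_zero {A : Type*} [CommRing A]
    [HenselianLocalRing A] {c : A} (hc : c ∈ maximalIdeal A) (r : A[X]) :
    ∃ x, 1 + x + c * x ^ 2 * r.eval x = 0 := by
  have hd : (C c * r.reverse).degree < ((r.natDegree + 2 : ℕ) : WithBot ℕ) := by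
    refine (degree_le_of_natDegree_le (n := r.natDegree) ?_).trans_lt (by norm_cast; omega)
    exact (natDegree_C_mul_le _ _).trans (reverse_natDegree_le r)
  have hm : (X ^ (r.natDegree + 2) + (X ^ (r.natDegree + 1) + C c * r.reverse)).Monic := by
    refine monic_X_pow_add ((degree_add_le _ _).trans_lt (max_lt ?_ hd))
    rw [degree_X_pow]; norm_cast; omega
  obtain ⟨v, hv, hv'⟩ := HenselianLocalRing.is_henselian _ hm (-1) (by
    simp only [eval_add, eval_mul, eval_pow, eval_X, eval_C]
    have : (-1 : A) ^ (r.natDegree + 2) + ((-1) ^ (r.natDegree + 1) + c * eval (-1) r.reverse)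
      = c * eval (-1) r.reverse := by ring
    rw [this]
    exact Ideal.mul_mem_right _ _ hc) (by
    have : eval (-1) (derivative (X ^ (r.natDegree + 2) +
        (X ^ (r.natDegree + 1) + C c * r.reverse))) =
        (-1) ^ (r.natDegree + 1) + c * eval (-1) (derivative r.reverse) := by
      simp only [derivative_add, derivative_mul, derivative_X_pow, derivative_C, eval_add,
        eval_mul, eval_pow, eval_X, eval_C, zero_mul, zero_add]
      simp only [Nat.add_sub_cancel, Nat.add_succ_sub_one]
      push_cast
      ring
    rw [this]
    by_contra hu
    have h1 := (mem_maximalIdeal _).2 hu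
    have h2 : (-1 : A) ^ (r.natDegree + 1) ∈ maximalIdeal A := by
      simpa using sub_mem h1 (Ideal.mul_mem_right (eval (-1) (derivative r.reverse)) _ hc)
    exact (mem_maximalIdeal _).1 h2 ((isUnit_one.neg).pow _))
  have hvu : IsUnit v := by
    by_contra hu
    have h1 := (mem_maximalIdeal _).2 hu
    have h2 : (1 : A) ∈ maximalIdeal A := by simpa using sub_mem hv' h1
    exact (mem_maximalIdeal _).1 h2 isUnit_one
  obtain ⟨u, rfl⟩ := hvu
  refine ⟨(u⁻¹ : Aˣ), ?_⟩
  let _ : Invertible ((u⁻¹ : Aˣ) : A) := ⟨u, by simp, by simp⟩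
  have h1 := eval₂_reverse_mul_pow (RingHom.id A) ((u⁻¹ : Aˣ) : A) r
  have h2 : (⅟((u⁻¹ : Aˣ) : A)) = u := rfl
  have h7 : eval (u : A) r.reverse * ((u⁻¹ : Aˣ) : A) ^ r.natDegree = eval ((u⁻¹ : Aˣ) : A) r := by
    rwa [h2, eval₂_id, eval₂_id] at h1
  rw [← h7]
  clear h1 h2 h7
  have h3 : (u : A) ^ (r.natDegree + 2) + ((u : A) ^ (r.natDegree + 1) +
      c * eval (u : A) r.reverse) = 0 := by
    simpa [IsRoot] using hv
  have h4 : (u : A) * (u⁻¹ : Aˣ) = 1 := by simp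
  have h5 := congrArg (fun t => t * ((u⁻¹ : Aˣ) : A) ^ (r.natDegree + 2)) h3
  have h6 : (u : A) ^ (r.natDegree + 1) * ((u⁻¹ : Aˣ) : A) ^ (r.natDegree + 1) = 1 := by
    rw [← mul_pow, h4, one_pow]
  simp only [zero_mul] at h5
  linear_combination h5 - h6 * (1 + ((u⁻¹ : Aˣ) : A)) -
    (u : A) ^ (r.natDegree + 1) * ((u⁻¹ : Aˣ) : A) ^ (r.natDegree + 1) * h4

/-- Newton approximation: an approximate zero of `h` that is good enough relative to the
derivative of `h` can be moved to an exact zero. -/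
theorem HenselianLocalRing.exists_ringHom_eq_zero {A R J : Type*} [CommRing A] [IsDomain A]
    [HenselianLocalRing A] [CommRing R] (f : R[X] →+* A) {h D E E' : R[X]} {N : J → R[X]}
    (hE : D * E = derivative h * E') {P U H : A} (hP : P ≠ 0) (hP' : ¬ IsUnit P)
    (hU : IsUnit U) (hh : f h = P ^ 4 * H) (hD : f (D * E) = P * U)
    (hN : ∀ j, P ∣ f (N j * E)) :
    ∃ f' : R[X] →+* A, f'.comp C = f.comp C ∧ f' h = 0 ∧ f' (D * E) ≠ 0 ∧
      ∀ j, f' D ∣ f' (N j) := by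
  obtain ⟨U, rfl⟩ := hU
  have hPm := (mem_maximalIdeal _).2 hP'
  have hf : ∀ F, f F = eval (f X) (F.map (f.comp C)) := by
    intro F
    rw [eval_map]
    have : f = eval₂RingHom (f.comp C) (f X) := ringHom_ext' (by ext; simp) (by simp)
    conv_lhs => rw [this]
    rfl
  let e := f (derivative h)
  let c := P ^ 2 * (f E' ^ 2 * ((U⁻¹ : Aˣ) : A) ^ 2 * H)
  have hc : c ∈ maximalIdeal A := Ideal.mul_mem_right _ _ (Ideal.pow_mem_of_mem _ hPm 2 two_pos)
  have hec : e ^ 2 * c = f h := by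
    have h1 : e * f E' = P * U := by rw [← map_mul, ← hE, hD]
    have h2 : (U : A) * (U⁻¹ : Aˣ) = 1 := by simp
    rw [hh]
    linear_combination (P ^ 2 * H * (U⁻¹ : Aˣ) ^ 2 * (e * f E' + P * U)) * h1 +
      P ^ 4 * H * ((U : A) * (U⁻¹ : Aˣ) + 1) * h2
  obtain ⟨q, hq⟩ := binomExpansion ((h.map (f.comp C)).map C) (C (f X)) (C e * X)
  obtain ⟨x, hx⟩ := HenselianLocalRing.exists_one_add_add_eq_zero hc (q.comp (C c * X))
  let w := f X + e * (c * x)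
  refine ⟨eval₂RingHom (f.comp C) w, by ext; simp, ?_, ?_⟩
  · have h1 := congrArg (eval (c * x)) hq
    have h3 : e = eval (f X) (derivative (h.map (f.comp C))) := by
      rw [derivative_map, ← hf]
    have h2 : eval (c * x) (eval (C (f X) + C e * X) ((h.map (f.comp C)).map C)) =
        eval₂ (f.comp C) w h := by
      rw [← coe_evalRingHom, ← Polynomial.eval₂_at_apply, eval₂_map]
      have : (evalRingHom (c * x)).comp C = RingHom.id A := by ext; simp
      rw [this, eval₂_id, eval_map]
      congr 1
      simp [w]
    have h5 : eval (c * x) (eval (C (f X)) ((h.map (f.comp C)).map C)) = f h := by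
      rw [eval_map, eval₂_at_apply, eval_C, ← hf]
    have h6 : eval (c * x) (eval (C (f X)) (derivative ((h.map (f.comp C)).map C))) = e := by
      rw [derivative_map, eval_map, eval₂_at_apply, eval_C, ← h3]
    rw [h2, eval_add, eval_add, eval_mul, eval_mul, h5, h6] at h1
    rw [coe_eval₂RingHom, h1, ← hec]
    simp only [eval_mul, eval_C, eval_X, eval_pow, eval_comp] at hx ⊢
    linear_combination e ^ 2 * c * hx
  have hcong : ∀ F, ∃ a, eval₂RingHom (f.comp C) w F = f F + P ^ 2 * a := by
    intro F
    obtain ⟨t, ht⟩ := sub_dvd_eval_sub w (f X) (F.map (f.comp C))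
    refine ⟨e * (f E' ^ 2 * ((U⁻¹ : Aˣ) : A) ^ 2 * H) * x * t, ?_⟩
    rw [← hf, eval_map, sub_eq_iff_eq_add] at ht
    rw [coe_eval₂RingHom, ht]
    simp only [w, c]
    ring
  have hDE : ∃ V : Aˣ, eval₂RingHom (f.comp C) w (D * E) = P * V := by
    obtain ⟨a, ha⟩ := hcong (D * E)
    have : IsUnit (U + P * a) := by
      by_contra hu
      have h1 := sub_mem ((mem_maximalIdeal _).2 hu) (Ideal.mul_mem_right a _ hPm)
      rw [add_sub_cancel_right] at h1
      exact (mem_maximalIdeal _).1 h1 U.isUnit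
    refine ⟨this.unit, ?_⟩
    rw [ha, hD, IsUnit.unit_spec]
    ring
  obtain ⟨V, hV⟩ := hDE
  have hne : eval₂RingHom (f.comp C) w (D * E) ≠ 0 := by
    rw [hV]
    exact mul_ne_zero hP V.ne_zero
  refine ⟨hne, fun j => ?_⟩
  have hE0 : eval₂RingHom (f.comp C) w E ≠ 0 := fun h0 => hne (by rw [map_mul, h0, mul_zero])
  rw [← mul_dvd_mul_iff_right hE0, ← map_mul, ← map_mul, hV, Units.mul_right_dvd]
  obtain ⟨a, ha⟩ := hcong (N j * E)
  rw [ha, pow_two, mul_assoc]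
  exact dvd_add (hN j) (dvd_mul_right _ _)

end

/-- Extend a ring homomorphism along a birational extension. -/
theorem Subring.exists_ringHom_closure_of_dvd {S A A' J : Type*} [CommRing S] [CommRing A]
    [CommRing A'] [IsDomain A'] (f : S →+* A) (f' : S →+* A') (hf : ∀ t, f t = 0 → f' t = 0)
    (z : J → A) {D : S} {N : J → S} (hN : ∀ j, f D * z j = f (N j)) (hD : f' D ≠ 0)
    (hN' : ∀ j, f' D ∣ f' (N j)) :
    ∃ φ : Subring.closure (Set.range z) →+* A', ∀ (x : Subring.closure (Set.range z)) (t t' : S),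
      f t * x = f t' →
      f' t * φ x = f' t' := by
  choose q hq using hN'
  let α : MvPolynomial J ℤ →+* A := MvPolynomial.eval₂Hom (Int.castRingHom A) z
  let α' : MvPolynomial J ℤ →+* A' := MvPolynomial.eval₂Hom (Int.castRingHom A') q
  have key : ∀ F : MvPolynomial J ℤ, ∃ n t, f D ^ n * α F = f t ∧ f' D ^ n * α' F = f' t := by
    intro F
    induction F using MvPolynomial.induction_on with
    | C a => exact ⟨0, a, by simp [α], by simp [α']⟩
    | add F G hF hG =>
      obtain ⟨n, t, h1, h2⟩ := hF
      obtain ⟨m, s, h3, h4⟩ := hG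
      refine ⟨n + m, D ^ m * t + D ^ n * s, ?_, ?_⟩
      · simp only [map_add, map_mul, map_pow]
        linear_combination f D ^ m * h1 + f D ^ n * h3
      · simp only [map_add, map_mul, map_pow]
        linear_combination f' D ^ m * h2 + f' D ^ n * h4
    | mul_X F j hF =>
      obtain ⟨n, t, h1, h2⟩ := hF
      refine ⟨n + 1, t * N j, ?_, ?_⟩
      · have : α (MvPolynomial.X j) = z j := by simp [α]
        rw [map_mul, map_mul, this, ← hN]
        linear_combination f D * z j * h1
      · have : α' (MvPolynomial.X j) = q j := by simp [α']
        rw [map_mul, map_mul, this, hq]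
        linear_combination f' D * q j * h2
  have hker : ∀ F, α F = 0 → α' F = 0 := by
    intro F hF
    obtain ⟨n, t, h1, h2⟩ := key F
    rw [hF, mul_zero, eq_comm] at h1
    rw [hf _ h1] at h2
    exact (mul_eq_zero.1 h2).resolve_left (pow_ne_zero _ hD)
  have hr : Subring.closure (Set.range z) ≤ α.range := by
    rw [Subring.closure_le]
    rintro _ ⟨j, rfl⟩
    exact ⟨MvPolynomial.X j, by simp [α]⟩
  let φ₀ : α.range →+* A' := (Ideal.Quotient.lift (RingHom.ker α) α' hker).comp
    (RingHom.quotientKerEquivRange α).symm.toRingHom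
  have hφ₀ : ∀ F, φ₀ ⟨α F, F, rfl⟩ = α' F := by
    intro F
    have : (RingHom.quotientKerEquivRange α).symm ⟨α F, F, rfl⟩ = Ideal.Quotient.mk _ F := by
      rw [RingEquiv.symm_apply_eq]; rfl
    change Ideal.Quotient.lift (RingHom.ker α) α' hker
      ((RingHom.quotientKerEquivRange α).symm ⟨α F, F, rfl⟩) = _
    rw [this]
    rfl
  refine ⟨φ₀.comp (Subring.inclusion hr), ?_⟩
  rintro ⟨x, hx⟩ t t' h
  obtain ⟨F, rfl⟩ := hr hx
  have h0 : (φ₀.comp (Subring.inclusion hr)) ⟨α F, hx⟩ = α' F := hφ₀ F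
  rw [h0]
  obtain ⟨n, s, h1, h2⟩ := key F
  have h3 : f (t * s - D ^ n * t') = 0 := by
    simp only [map_sub, map_mul, map_pow]
    linear_combination (- f t) * h1 + f D ^ n * h
  have h4 := hf _ h3
  simp only [map_sub, map_mul, map_pow] at h4
  refine mul_left_cancel₀ (pow_ne_zero n hD) ?_
  linear_combination f' t * h2 + h4

section

open IsLocalRing Polynomial

namespace Polynomial.IsDistinguishedAt

variable {B : Type*} [CommRing B] {I : Ideal B} [IsAdicComplete I B] {P : B[X]}

theorem dvd_of_coe_dvd_coe (hP : P.IsDistinguishedAt I) {F : B[X]}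
    (h : (P : PowerSeries B) ∣ F) : P ∣ F := by
  rw [← Ideal.mem_span_singleton, ← Ideal.Quotient.eq_zero_iff_mem]
  apply hP.algEquivQuotient.injective
  rw [map_zero]
  have : hP.algEquivQuotient (Ideal.Quotient.mk _ F) = Ideal.Quotient.mk _ (F : PowerSeries B) :=
    rfl
  rw [this, Ideal.Quotient.eq_zero_iff_mem, Ideal.mem_span_singleton]
  exact h

theorem exists_coe_sub_dvd (hP : P.IsDistinguishedAt I) (a : PowerSeries B) :
    ∃ F : B[X], (P : PowerSeries B) ∣ F - a := by
  obtain ⟨F, hF⟩ := hP.algEquivQuotient.surjective (Ideal.Quotient.mk _ a)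
  obtain ⟨F, rfl⟩ := Ideal.Quotient.mk_surjective F
  refine ⟨F, ?_⟩
  rw [← Ideal.mem_span_singleton, ← Ideal.Quotient.mk_eq_mk_iff_sub_mem]
  exact hF

end Polynomial.IsDistinguishedAt

theorem Polynomial.exists_ringHom_approximation {B ι J : Type*} [CommRing B] [IsDomain B]
    [IsLocalRing B] [IsAdicComplete (maximalIdeal B) B]
    (f : (MvPolynomial ι ℤ)[X] →+* PowerSeries B)
    {h D E : (MvPolynomial ι ℤ)[X]} {N : J → (MvPolynomial ι ℤ)[X]} (hh : f h = 0)
    (hreg : (f (D * E)).map (residue B) ≠ 0) (hnu : ¬ IsUnit (f (D * E)))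
    (hN : ∀ j, f D ∣ f (N j)) :
    ∃ (f₀ : (MvPolynomial ι ℤ)[X] →+* B[X]) (P U H : B[X]) (V : J → B[X]),
      P.Monic ∧ P.coeff 0 ∈ maximalIdeal B ∧ IsUnit (U.coeff 0) ∧ f₀ h = P ^ 4 * H ∧
      f₀ (D * E) = P * U ∧ (∀ j, f₀ (N j * E) = P * V j) ∧
      ∀ i (a : B[X]), f (C (MvPolynomial.X i)) = a → f₀ (C (MvPolynomial.X i)) = a := by
  obtain ⟨P, W, hPd, hW, hPW⟩ := PowerSeries.exists_isWeierstrassFactorization hreg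
  have hP4 : (P ^ 4).IsDistinguishedAt (maximalIdeal B) := by
    have : P ^ 4 = (P * P) * (P * P) := by ring
    rw [this]
    exact (hPd.mul hPd).mul (hPd.mul hPd)
  have happ : ∀ x : PowerSeries B, ∃ F : B[X], ((P ^ 4 : B[X]) : PowerSeries B) ∣ F - x ∧
      ∀ a : B[X], x = a → F = a := by
    intro x
    by_cases hx : ∃ a : B[X], x = a
    · obtain ⟨a, rfl⟩ := hx
      exact ⟨a, by simp, fun b hb => Polynomial.coe_injective _ hb⟩
    · obtain ⟨F, hF⟩ := hP4.exists_coe_sub_dvd x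
      exact ⟨F, hF, fun a ha => absurd ⟨a, ha⟩ hx⟩
  choose b hb hb' using happ
  let f₀ : (MvPolynomial ι ℤ)[X] →+* B[X] := eval₂RingHom
    (MvPolynomial.eval₂Hom (Int.castRingHom B[X]) fun i => b (f (C (MvPolynomial.X i)))) (b (f X))
  have hcong : ∀ F, ((P ^ 4 : B[X]) : PowerSeries B) ∣ f₀ F - f F := by
    intro F
    have : (Ideal.Quotient.mk (Ideal.span {((P ^ 4 : B[X]) : PowerSeries B)})).comp
        (Polynomial.coeToPowerSeries.ringHom.comp f₀) =
        (Ideal.Quotient.mk (Ideal.span {((P ^ 4 : B[X]) : PowerSeries B)})).comp f := by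
      refine Polynomial.ringHom_ext' (MvPolynomial.ringHom_ext' (RingHom.ext_int _ _)
        fun i => ?_) ?_
      · simp only [RingHom.comp_apply, f₀, coe_eval₂RingHom, eval₂_C, MvPolynomial.coe_eval₂Hom,
          MvPolynomial.eval₂_X]
        rw [Ideal.Quotient.mk_eq_mk_iff_sub_mem, Ideal.mem_span_singleton]
        exact hb _
      · simp only [RingHom.comp_apply, f₀, coe_eval₂RingHom, eval₂_X]
        rw [Ideal.Quotient.mk_eq_mk_iff_sub_mem, Ideal.mem_span_singleton]
        exact hb _
    have := RingHom.congr_fun this F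
    rw [← Ideal.mem_span_singleton, ← Ideal.Quotient.mk_eq_mk_iff_sub_mem]
    exact this
  have hPP : (P : PowerSeries B) ∣ ((P ^ 4 : B[X]) : PowerSeries B) := by
    rw [Polynomial.coe_pow]
    exact dvd_pow_self _ (by norm_num)
  obtain ⟨H, hH⟩ := hP4.dvd_of_coe_dvd_coe (F := f₀ h) (by simpa [hh] using hcong h)
  have hDE : P ∣ f₀ (D * E) := hPd.dvd_of_coe_dvd_coe (by
    have := dvd_add (hPP.trans (hcong (D * E))) (Dvd.intro W hPW.symm)
    rwa [sub_add_cancel] at this)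
  obtain ⟨U, hU⟩ := hDE
  have hV : ∀ j, ∃ V, f₀ (N j * E) = P * V := fun j => hPd.dvd_of_coe_dvd_coe (by
    have h1 : f (D * E) ∣ f (N j * E) := by
      rw [map_mul, map_mul]; exact mul_dvd_mul_right (hN j) _
    have := dvd_add (hPP.trans (hcong (N j * E))) ((Dvd.intro W hPW.symm).trans h1)
    rwa [sub_add_cancel] at this)
  choose V hV using hV
  have hP0 : P.coeff 0 ∈ maximalIdeal B := by
    intro hu
    apply hnu
    rw [hPW]
    refine IsUnit.mul ?_ hW
    rw [PowerSeries.isUnit_iff_constantCoeff]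
    simpa using hu
  refine ⟨f₀, P, U, H, V, hPd.monic, hP0, ?_, hH, hU, hV, fun i a ha => ?_⟩
  · obtain ⟨t, ht⟩ := hcong (D * E)
    have h1 : (P : PowerSeries B) * U = P * (W + P ^ 3 * t) := by
      rw [← Polynomial.coe_mul, ← hU, ← sub_eq_zero]
      rw [Polynomial.coe_pow, hPW] at ht
      linear_combination ht
    have h2 : (U : PowerSeries B) = W + P ^ 3 * t := by
      refine mul_left_cancel₀ (fun h0 => hPd.monic.ne_zero ?_) h1
      exact Polynomial.coe_injective _ (h0.trans Polynomial.coe_zero.symm)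
    have h3 := congrArg PowerSeries.constantCoeff h2
    rw [Polynomial.constantCoeff_coe] at h3
    rw [h3]
    by_contra hu
    have h4 := (mem_maximalIdeal _).2 hu
    rw [map_add, map_mul, map_pow, Polynomial.constantCoeff_coe] at h4
    have h5 := sub_mem h4 (Ideal.mul_mem_right (PowerSeries.constantCoeff t) _
      (Ideal.pow_mem_of_mem _ hP0 3 (by norm_num)))
    rw [add_sub_cancel_right] at h5
    exact (mem_maximalIdeal _).1 h5 (PowerSeries.isUnit_iff_constantCoeff.1 hW)
  · simp only [f₀, coe_eval₂RingHom, eval₂_C, MvPolynomial.coe_eval₂Hom, MvPolynomial.eval₂_X]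
    exact hb' _ a ha

end

section

open Polynomial

theorem exists_isIntegral_primitive (M G : Type*) [CommRing M] [IsDomain M] [CharZero M]
    [CommRing G] [IsDomain G] [Algebra M G] [FaithfulSMul M G] [Algebra.FiniteType M G]
    [Algebra.IsAlgebraic M G] :
    ∃ w : G, IsIntegral M w ∧ ∀ z : G, ∃ D : M, D ≠ 0 ∧ ∃ N : M[X], D • z = aeval w N := by
  have : FaithfulSMul M (FractionRing G) := inferInstance
  let _ : Algebra (FractionRing M) (FractionRing G) := FractionRing.liftAlgebra M (FractionRing G)
  have : CharZero (FractionRing M) := inferInstance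
  have : Algebra.EssFiniteType (FractionRing M) (FractionRing G) :=
    Algebra.EssFiniteType.of_comp M (FractionRing M) (FractionRing G)
  have : Algebra.IsAlgebraic M (FractionRing G) :=
    have : Algebra.IsAlgebraic G (FractionRing G) :=
      IsLocalization.isAlgebraic (FractionRing G) (nonZeroDivisors G)
    Algebra.IsAlgebraic.trans M G (FractionRing G)
  have : Algebra.IsAlgebraic (FractionRing M) (FractionRing G) := inferInstance
  have : FiniteDimensional (FractionRing M) (FractionRing G) :=
    Algebra.finite_of_essFiniteType_of_isAlgebraic
  obtain ⟨α, hα⟩ := Field.exists_primitive_element (FractionRing M) (FractionRing G)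
  obtain ⟨x, y, hy, rfl⟩ := IsFractionRing.div_surjective G α
  obtain ⟨r, hr, c, hc⟩ := (Algebra.IsAlgebraic.isAlgebraic (R := M) y).exists_nonzero_dvd hy
  obtain ⟨t, ht, htx⟩ :=
    (Algebra.IsAlgebraic.isAlgebraic (R := M) (x * c)).exists_integral_multiple
  refine ⟨_, htx, fun z => ?_⟩
  have hz : algebraMap G (FractionRing G) z ∈ Algebra.adjoin (FractionRing M)
      {algebraMap G (FractionRing G) x / algebraMap G (FractionRing G) y} := by
    rw [IntermediateField.adjoin_eq_top_iff.1 hα]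
    trivial
  rw [Algebra.adjoin_singleton_eq_range_aeval] at hz
  obtain ⟨q, hq⟩ := hz
  have hs : algebraMap M (FractionRing M) (t * r) ≠ 0 :=
    (map_ne_zero_iff _ (IsFractionRing.injective M (FractionRing M))).2 (mul_ne_zero ht hr)
  have hy0 : algebraMap G (FractionRing G) y ≠ 0 :=
    (map_ne_zero_iff _ (IsFractionRing.injective G (FractionRing G))).2
      (nonZeroDivisors.ne_zero hy)
  have hw : algebraMap G (FractionRing G) (t • (x * c)) =
      algebraMap (FractionRing M) (FractionRing G) (algebraMap M (FractionRing M) (t * r)) *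
        (algebraMap G (FractionRing G) x / algebraMap G (FractionRing G) y) := by
    rw [← IsScalarTower.algebraMap_apply, IsScalarTower.algebraMap_apply M G (FractionRing G),
      map_mul, hc, Algebra.smul_def, eq_comm, mul_div_assoc', div_eq_iff hy0]
    simp only [map_mul]
    ring
  obtain ⟨D, hD, hN⟩ := IsLocalization.integerNormalization_spec (nonZeroDivisors M)
    (q.comp (C (algebraMap M (FractionRing M) (t * r))⁻¹ * X))
  refine ⟨D, nonZeroDivisors.ne_zero hD, IsLocalization.integerNormalization (nonZeroDivisors M)
    (q.comp (C (algebraMap M (FractionRing M) (t * r))⁻¹ * X)), ?_⟩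
  apply IsFractionRing.injective G (FractionRing G)
  have h1 := congrArg (aeval (algebraMap G (FractionRing G) (t • (x * c)))) hN
  rw [aeval_map_algebraMap, aeval_algebraMap_apply] at h1
  have h2 : ∀ p : (FractionRing M)[X], D • p = C (algebraMap M (FractionRing M) D) * p :=
    fun p => by rw [← Polynomial.smul_eq_C_mul, algebraMap_smul]
  rw [h1, h2, map_mul, aeval_C, aeval_comp, Algebra.smul_def, map_mul,
    ← IsScalarTower.algebraMap_apply, ← IsScalarTower.algebraMap_apply, ← hq]
  congr 1
  rw [map_mul, aeval_C, aeval_X, hw, ← mul_assoc, ← map_mul, inv_mul_cancel₀ hs, map_one, one_mul]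
  rfl

end

section

open Polynomial

theorem exists_polynomial_presentation {G : Type u} [CommRing G] [IsDomain G] [CharZero G]
    {n : ℕ} {y : Fin n → G} (hy : AlgebraicIndependent ℤ y) (Z : Finset G)
    (hZ : Algebra.adjoin ℤ (Z : Set G) = ⊤) (hyZ : ∀ i, y i ∈ Z) :
    ∃ (ι : Type u) (_ : Finite ι) (f : (MvPolynomial ι ℤ)[X] →+* G)
      (h D : (MvPolynomial ι ℤ)[X]) (N : Z → (MvPolynomial ι ℤ)[X]),
      (∀ i, ∃ j, f (C (MvPolynomial.X j)) = y i) ∧ f h = 0 ∧ f (derivative h) ≠ 0 ∧ f D ≠ 0 ∧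
      (∀ z : Z, f D * z = f (N z)) ∧ ∀ F, f F = 0 → h ∣ F := by
  classical
  have : Algebra.IsAlgebraic (Algebra.adjoin ℤ (Z : Set G)) G := by
    rw [hZ]
    exact ⟨fun x => isAlgebraic_algebraMap (⟨x, trivial⟩ : (⊤ : Subalgebra ℤ G))⟩
  obtain ⟨s, hys, hsZ, hs⟩ := exists_isTranscendenceBasis_between (R := ℤ) (Set.range y)
    (Z : Set G) (Set.range_subset_iff.2 hyZ) ((algebraicIndependent_subtype_range
      hy.injective).2 hy)
  have hsf : Finite s := (Z.finite_toSet.subset hsZ).to_subtype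
  let _ : Algebra (MvPolynomial s ℤ) G :=
    (MvPolynomial.aeval ((↑) : s → G) : MvPolynomial s ℤ →ₐ[ℤ] G).toRingHom.toAlgebra
  have hmap : ∀ p : MvPolynomial s ℤ, algebraMap _ G p = MvPolynomial.aeval ((↑) : s → G) p :=
    fun p => rfl
  have : FaithfulSMul (MvPolynomial s ℤ) G :=
    (faithfulSMul_iff_algebraMap_injective _ _).2 hs.1
  have : IsScalarTower ℤ (MvPolynomial s ℤ) G :=
    IsScalarTower.of_algebraMap_eq' (Subsingleton.elim _ _)
  have : Algebra.FiniteType ℤ G := ⟨⟨Z, hZ⟩⟩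
  have : Algebra.FiniteType (MvPolynomial s ℤ) G :=
    Algebra.FiniteType.of_restrictScalars_finiteType ℤ _ _
  have : Algebra.IsAlgebraic (MvPolynomial s ℤ) G := by
    have h1 := hs.isAlgebraic
    rw [Algebra.adjoin_range_eq_range_aeval] at h1
    exact Algebra.IsAlgebraic.of_ringHom_of_comp_eq
      (MvPolynomial.aeval ((↑) : s → G) : MvPolynomial s ℤ →ₐ[ℤ] G).rangeRestrict (RingHom.id G)
      (AlgHom.rangeRestrict_surjective _) Function.injective_id rfl
  obtain ⟨w, hw, hN⟩ := exists_isIntegral_primitive (MvPolynomial s ℤ) G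
  choose D hD N hN using hN
  have hderiv : aeval w (derivative (minpoly (MvPolynomial s ℤ) w)) ≠ 0 := by
    intro h0
    have hdeg := minpoly.natDegree_pos hw
    have h1 : derivative (minpoly (MvPolynomial s ℤ) w) ≠ 0 := fun h1 =>
      hdeg.ne' (derivative_eq_zero.1 h1)
    have h2 := natDegree_le_of_dvd (minpoly.isIntegrallyClosed_dvd hw h0) h1
    exact absurd (natDegree_derivative_lt hdeg.ne') (not_lt.2 h2)
  have hD' : aeval w (C (∏ z : Z, D z)) ≠ 0 := by
    rw [aeval_C]
    exact (map_ne_zero_iff _ hs.1).2 (Finset.prod_ne_zero_iff.2 fun z _ => hD z)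
  refine ⟨s, hsf, (aeval w : (MvPolynomial s ℤ)[X] →ₐ[MvPolynomial s ℤ] G).toRingHom,
    minpoly (MvPolynomial s ℤ) w, C (∏ z : Z, D z),
    fun z => C (∏ z' ∈ Finset.univ.erase z, D z') * N z, ?_, minpoly.aeval _ _, hderiv, hD', ?_,
    fun F hF => minpoly.isIntegrallyClosed_dvd hw hF⟩
  · intro i
    refine ⟨⟨y i, hys ⟨i, rfl⟩⟩, ?_⟩
    simp [hmap]
  · intro z
    simp only [AlgHom.toRingHom_eq_coe, RingHom.coe_coe]
    rw [map_mul (aeval w), ← hN z, aeval_C, aeval_C, Algebra.smul_def, ← mul_assoc, ← map_mul,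
      Finset.prod_erase_mul _ _ (Finset.mem_univ z)]

end

theorem exists_weight_unique_min (n : ℕ) {S : Set (Fin (n + 1) → ℕ)} (hS : S.Nonempty) :
    ∃ e : Fin (n + 1) → ℕ, e 0 = 1 ∧ (∀ i, 0 < e i) ∧
      ∃ a ∈ S, ∀ b ∈ S, ∑ i, e i * b i ≤ ∑ i, e i * a i → b = a := by
  induction n with
  | zero =>
    refine ⟨fun _ => 1, rfl, fun _ => one_pos, ?_⟩
    obtain ⟨a, ha, hmin⟩ := exists_minimal_of_wellFoundedLT (fun m => ∃ a ∈ S, a 0 = m)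
      (let ⟨a, ha⟩ := hS; ⟨a 0, a, ha, rfl⟩)
    obtain ⟨a, haS, rfl⟩ := ha
    refine ⟨a, haS, fun b hb h => ?_⟩
    simp only [Fin.sum_univ_succ, one_mul, Finset.univ_eq_empty, Finset.sum_empty, add_zero] at h
    have := hmin ⟨b, hb, rfl⟩ h
    funext i
    rw [Fin.eq_zero i]
    omega
  | succ n ih =>
    obtain ⟨m, hm, hmin⟩ := exists_minimal_of_wellFoundedLT
      (fun m => ∃ a ∈ S, a (Fin.last _) = m) (let ⟨a, ha⟩ := hS; ⟨a _, a, ha, rfl⟩)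
    obtain ⟨a₀, ha₀, h₀⟩ := hm
    obtain ⟨e, he, hpos, a, ha, hu⟩ := ih (S := {a | Fin.snoc a m ∈ S})
      ⟨Fin.init a₀, by rw [Set.mem_ofPred_eq, ← h₀, Fin.snoc_init_self]; exact ha₀⟩
    refine ⟨Fin.snoc e (∑ i, e i * a i + 1), ?_, ?_, Fin.snoc a m, ha, fun b hb h => ?_⟩
    · rw [← Fin.castSucc_zero, Fin.snoc_castSucc, he]
    · intro i
      induction i using Fin.lastCases with
      | last => simp
      | cast i => simpa using hpos i
    · rw [Fin.sum_univ_castSucc (n := n + 1), Fin.sum_univ_castSucc (n := n + 1)] at h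
      simp only [Fin.snoc_castSucc, Fin.snoc_last] at h
      have hbm : m ≤ b (Fin.last _) := by
        by_contra! hlt
        exact absurd (hmin ⟨b, hb, rfl⟩ hlt.le) (not_le.2 hlt)
      have hle : b (Fin.last _) = m := by
        by_contra hne
        have h1 : m + 1 ≤ b (Fin.last _) := by omega
        have h2 := Nat.mul_le_mul_left (∑ i, e i * a i + 1) h1
        rw [mul_add] at h2
        omega
      have hb' : (Fin.snoc (Fin.init b) m : Fin (n + 2) → ℕ) = b := by
        rw [← hle, Fin.snoc_init_self]
      rw [← hb']
      congr 1
      refine hu _ (by rw [Set.mem_ofPred_eq, hb']; exact hb) ?_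
      rw [hle] at h
      have := le_of_add_le_add_right h
      simpa [Fin.init] using this

namespace MvPowerSeries

variable {k : Type*} [CommRing k] {d : ℕ}

/-- The restriction of a power series to the first coordinate axis. -/
noncomputable def restrictAxis : MvPowerSeries (Fin (d + 1)) k →+* PowerSeries k :=
  (PowerSeries.map constantCoeff).comp (finSuccEquiv k d).toRingHom

theorem coeff_restrictAxis (g : MvPowerSeries (Fin (d + 1)) k) (v : ℕ) :
    PowerSeries.coeff v (restrictAxis g) = coeff (Finsupp.cons v 0) g := by
  rw [← coeff_coeff_finSuccEquiv]
  simp [restrictAxis]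

theorem restrictAxis_X_zero :
    restrictAxis (X 0 : MvPowerSeries (Fin (d + 1)) k) = PowerSeries.X := by
  simp [restrictAxis, finSuccEquiv_X_zero]

theorem restrictAxis_X_succ (i : Fin d) :
    restrictAxis (X i.succ : MvPowerSeries (Fin (d + 1)) k) = 0 := by
  simp [restrictAxis, finSuccEquiv_X_succ]

/-- The images of the coordinates under a shear along the first coordinate axis. -/
noncomputable def shear (k : Type*) [CommRing k] (c : k) (e : Fin (d + 1) → ℕ) (i : Fin (d + 1)) :
    MvPowerSeries (Fin (d + 1)) k :=
  Fin.cases (X 0) (fun j => X j.succ + C c * X 0 ^ e j.succ) i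

theorem hasSubst_shear (c : k) {e : Fin (d + 1) → ℕ} (he : ∀ i, 0 < e i) :
    HasSubst (shear k c e) := by
  refine hasSubst_of_constantCoeff_zero fun i => ?_
  induction i using Fin.cases with
  | zero => simp [shear]
  | succ j => simp [shear, (he _).ne']

theorem exists_restrictAxis_subst_shear_ne_zero {g : MvPowerSeries (Fin (d + 1)) k} (hg : g ≠ 0) :
    ∃ e : Fin (d + 1) → ℕ, (∀ i, 0 < e i) ∧ restrictAxis (subst (shear k 1 e) g) ≠ 0 := by
  obtain ⟨b, hb⟩ : ∃ b, coeff b g ≠ 0 := by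
    by_contra! h
    exact hg (MvPowerSeries.ext h)
  obtain ⟨e, he0, he, a, ⟨a, ha, rfl⟩, hu⟩ := exists_weight_unique_min d
    (S := (fun b : Fin (d + 1) →₀ ℕ => (b : Fin (d + 1) → ℕ)) '' {b | coeff b g ≠ 0})
    ⟨_, b, hb, rfl⟩
  refine ⟨e, he, fun h => ha ?_⟩
  have h1 := congrArg (PowerSeries.coeff (∑ i, e i * a i)) h
  have hr : ∀ i, restrictAxis (shear k 1 e i) = PowerSeries.X ^ e i := by
    intro i
    induction i using Fin.cases with
    | zero => simp [shear, restrictAxis_X_zero, he0]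
    | succ j => simp [shear, restrictAxis_X_zero, restrictAxis_X_succ]
  have hm : ∀ b : Fin (d + 1) →₀ ℕ, coeff (Finsupp.cons (∑ i, e i * a i) 0)
      (b.prod fun s n => shear k 1 e s ^ n) = if ∑ i, e i * a i = ∑ i, e i * b i then 1 else 0 := by
    intro b
    rw [← coeff_restrictAxis, Finsupp.prod_fintype _ _ (by simp), map_prod]
    simp only [map_pow, hr, ← pow_mul]
    rw [Finset.prod_pow_eq_pow_sum, PowerSeries.coeff_X_pow]
  rw [coeff_restrictAxis, coeff_subst (hasSubst_shear 1 he), map_zero, finsum_eq_single _ a] at h1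
  · rw [hm, if_pos rfl] at h1
    simpa using h1
  · intro b hba
    rw [hm]
    split_ifs with hab
    · have : coeff b g = 0 := by
        by_contra hb
        exact hba (DFunLike.coe_injective (hu _ ⟨b, hb, rfl⟩ hab.ge))
      rw [this, zero_smul]
    · rw [smul_zero]

theorem subst_shear_subst_shear {c : k} {e : Fin (d + 1) → ℕ} (he : ∀ i, 0 < e i)
    (g : MvPowerSeries (Fin (d + 1)) k) : subst (shear k (-c) e) (subst (shear k c e) g) = g := by
  rw [subst_comp_subst_apply (hasSubst_shear c he) (hasSubst_shear (-c) he)]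
  refine Eq.trans (congrArg (subst · g) (funext fun i => ?_))
    (congrFun (subst_self (σ := Fin (d + 1)) (R := k)) g)
  have hs := hasSubst_shear (-c) he
  induction i using Fin.cases with
  | zero => simp [shear, subst_X hs]
  | succ j =>
    have h0 : shear k (-c) e 0 = X 0 := rfl
    have h1 : shear k (-c) e j.succ = X j.succ + C (-c) * X 0 ^ e j.succ := rfl
    have h2 : shear k c e j.succ = X j.succ + C c * X 0 ^ e j.succ := rfl
    rw [h2, subst_add hs, subst_mul hs, subst_pow hs, subst_X hs, subst_X hs, subst_C, h0, h1]
    simp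

end MvPowerSeries

section

open IsLocalRing Polynomial

theorem Subring.adjoin_int_eq_top {A : Type*} [CommRing A] {G : Subring A} {S : Set A}
    (hS : Subring.closure S = G) {Z : Set G} (hZ : ∀ x : G, (x : A) ∈ S → x ∈ Z) :
    Algebra.adjoin ℤ Z = ⊤ := by
  rw [Algebra.eq_top_iff]
  intro x
  have h1 : G ≤ (Algebra.adjoin ℤ Z).toSubring.map G.subtype := by
    conv_lhs => rw [← hS]
    rw [Subring.closure_le]
    intro s hs
    have hsG : s ∈ G := hS ▸ Subring.subset_closure hs
    exact ⟨⟨s, hsG⟩, Algebra.subset_adjoin (hZ _ hs), rfl⟩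
  obtain ⟨x', hx', h2⟩ := h1 x.2
  rwa [← Subtype.ext h2]

namespace MvPowerSeries

/-- The existence of characteristic `p` specializations of finitely generated rings of power
series in `d` variables over `k`. -/
def HasCharPSpecialization (k : Type u) [Field k] (d : ℕ) : Prop :=
  ∀ (G : Subring (MvPowerSeries (Fin d) k)),
    (∃ S : Finset (MvPowerSeries (Fin d) k), Subring.closure S = G) →
    ∀ (hX : ∀ i, MvPowerSeries.X i ∈ G) (g : G), g ≠ 0 →
    ∃ (k' : Type u) (_ : Field k') (p : ℕ) (_ : p.Prime) (_ : CharP k' p)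
      (φ : G →+* MvPowerSeries (Fin d) k'),
      (∀ i, φ ⟨MvPowerSeries.X i, hX i⟩ = MvPowerSeries.X i) ∧ φ g ≠ 0

theorem HasCharPSpecialization.polynomial {k : Type u} [Field k] {d : ℕ}
    (hk : HasCharPSpecialization k d) (T : Finset (MvPowerSeries (Fin d) k)[X]) :
    ∃ (k' : Type u) (_ : Field k') (p : ℕ) (_ : p.Prime) (_ : CharP k' p)
      (G : Subring (MvPowerSeries (Fin d) k)) (hX : ∀ i, MvPowerSeries.X i ∈ G)
      (θ : G[X] →+* MvPowerSeries (Fin (d + 1)) k'),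
      (∀ q ∈ T, ∃ q' : G[X], q'.map G.subtype = q) ∧ θ Polynomial.X = MvPowerSeries.X 0 ∧
      (∀ i, θ (Polynomial.C ⟨_, hX i⟩) = MvPowerSeries.X i.succ) ∧
      (∀ q : G[X], q.Monic → θ q ≠ 0) ∧
      (∀ q : G[X], q.map G.subtype ∈ T → IsUnit ((q.map G.subtype).coeff 0) → IsUnit (θ q)) ∧
      (∀ q : G[X], q.map G.subtype ∈ T →
        (q.map G.subtype).coeff 0 ∈ maximalIdeal (MvPowerSeries (Fin d) k) → ¬ IsUnit (θ q)) := by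
  classical
  have hc : ∀ b : MvPowerSeries (Fin d) k, ∃ c : Fin d → MvPowerSeries (Fin d) k,
      b ∈ maximalIdeal (MvPowerSeries (Fin d) k) → ∑ i, c i * MvPowerSeries.X i = b := by
    intro b
    by_cases hb : b ∈ maximalIdeal (MvPowerSeries (Fin d) k)
    · rw [maximalIdeal_eq_span, Ideal.mem_span_range_iff_exists_fun] at hb
      exact hb.imp fun c hc _ => hc
    · exact ⟨0, fun h => absurd h hb⟩
  choose c hc using hc
  let S : Finset (MvPowerSeries (Fin d) k) := Finset.univ.image MvPowerSeries.X ∪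
    T.biUnion fun q => q.coeffs ∪ {Ring.inverse (q.coeff 0)} ∪ Finset.univ.image (c (q.coeff 0))
  have hS : ∀ s ∈ S, s ∈ Subring.closure (S : Set (MvPowerSeries (Fin d) k)) :=
    fun s hs => Subring.subset_closure hs
  have hX : ∀ i, MvPowerSeries.X i ∈ Subring.closure (S : Set (MvPowerSeries (Fin d) k)) :=
    fun i => hS _ (by simp [S])
  have hinv : ∀ q ∈ T, Ring.inverse (q.coeff 0) ∈
      Subring.closure (S : Set (MvPowerSeries (Fin d) k)) := fun q hq => by
    refine hS _ (Finset.mem_union_right _ (Finset.mem_biUnion.2 ⟨q, hq, by simp⟩))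
  have hcS : ∀ q ∈ T, ∀ i, c (q.coeff 0) i ∈
      Subring.closure (S : Set (MvPowerSeries (Fin d) k)) := fun q hq i => by
    refine hS _ (Finset.mem_union_right _ (Finset.mem_biUnion.2 ⟨q, hq, by simp⟩))
  have hcoeff : ∀ q ∈ T, ∀ n, q.coeff n ∈
      Subring.closure (S : Set (MvPowerSeries (Fin d) k)) := fun q hq n => by
    by_cases hn : q.coeff n = 0
    · rw [hn]
      exact zero_mem _
    · refine hS _ (Finset.mem_union_right _ (Finset.mem_biUnion.2 ⟨q, hq, ?_⟩))
      simp [Polynomial.coeff_mem_coeffs hn]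
  obtain ⟨k', _, p, hp, hcp, φ, hφ, -⟩ := hk _ ⟨S, rfl⟩ hX 1 one_ne_zero
  let θ : (Subring.closure (S : Set (MvPowerSeries (Fin d) k)))[X] →+*
      MvPowerSeries (Fin (d + 1)) k' := (finSuccEquiv k' d).symm.toRingHom.comp
        (Polynomial.coeToPowerSeries.ringHom.comp (mapRingHom φ))
  have hθ : ∀ q, θ q = (finSuccEquiv k' d).symm ((q.map φ : _[X]) : PowerSeries _) := fun q => rfl
  have hu : ∀ q, IsUnit (θ q) ↔ IsUnit (φ (q.coeff 0)) := fun q => by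
    rw [hθ, MulEquiv.isUnit_map, PowerSeries.isUnit_iff_constantCoeff,
      ← PowerSeries.coeff_zero_eq_constantCoeff_apply, Polynomial.coeff_coe, Polynomial.coeff_map]
  refine ⟨k', _, p, hp, hcp, _, hX, θ, fun q hq => ?_, ?_, fun i => ?_, fun q hq => ?_,
    fun q hq h => ?_, fun q hq h => ?_⟩
  · refine (Polynomial.mem_lifts q).1 ((Polynomial.lifts_iff_coeff_lifts q).2 fun n => ?_)
    exact ⟨⟨_, hcoeff q hq n⟩, rfl⟩
  · rw [hθ, AlgEquiv.symm_apply_eq, finSuccEquiv_X_zero]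
    simp
  · rw [hθ, AlgEquiv.symm_apply_eq, finSuccEquiv_X_succ]
    simp [hφ]
  · rw [hθ, map_ne_zero_iff _ (AlgEquiv.injective _), Ne, Polynomial.coe_eq_zero_iff]
    exact (hq.map φ).ne_zero
  · rw [hu]
    refine IsUnit.map φ (IsUnit.of_mul_eq_one ⟨_, hinv _ hq⟩ (Subtype.ext ?_))
    simpa using Ring.mul_inverse_cancel _ h
  · rw [hu]
    have h1 : q.coeff 0 = ∑ i, ⟨_, hcS _ hq i⟩ * ⟨_, hX i⟩ := by
      refine Subtype.ext ?_
      rw [AddSubmonoidClass.coe_finsetSum]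
      simpa using (hc _ h).symm
    rw [h1, map_sum, isUnit_iff_constantCoeff, map_sum]
    simp only [map_mul, hφ, constantCoeff_X, mul_zero, Finset.sum_const_zero, not_isUnit_zero,
      not_false_eq_true]

end MvPowerSeries

end

section

open IsLocalRing Polynomial

namespace MvPowerSeries

theorem isAdicComplete_maximalIdeal (k : Type*) [Field k] (d : ℕ) :
    IsAdicComplete (maximalIdeal (MvPowerSeries (Fin d) k)) (MvPowerSeries (Fin d) k) := by
  rw [maximalIdeal_eq_span]
  infer_instance

theorem henselianLocalRing (k : Type*) [Field k] (d : ℕ) :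
    HenselianLocalRing (MvPowerSeries (Fin d) k) := by
  have := isAdicComplete_maximalIdeal k d
  exact { is_henselian := fun f hf a h1 h2 =>
    HenselianRing.is_henselian f hf a h1 (h2.map (Ideal.Quotient.mk _)) }

end MvPowerSeries

theorem MvPolynomial.map_eval₂_intCast_eq {σ A B C : Type*} [CommRing A] [CommRing B] [CommRing C]
    (φ : A →+* C) (ψ : B →+* C) {v : σ → A} {w : σ → B} (h : ∀ i, φ (v i) = ψ (w i))
    (t : MvPolynomial σ ℤ) :
    φ (t.eval₂ (Int.castRingHom A) v) = ψ (t.eval₂ (Int.castRingHom B) w) := by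
  rw [MvPolynomial.eval₂_comp_left, MvPolynomial.eval₂_comp_left,
    RingHom.eq_intCast' (φ.comp (Int.castRingHom A)),
    RingHom.eq_intCast' (ψ.comp (Int.castRingHom B))]
  exact congrArg (fun u => t.eval₂ _ u) (_root_.funext h)

theorem Polynomial.exists_comp_mapRingHom_eq {ι B : Type*} [CommRing B] (G : Subring B)
    (f : (MvPolynomial ι ℤ)[X] →+* B[X]) (hC : ∀ i, ∃ q : G[X], q.map G.subtype = f (C (.X i)))
    (hX : ∃ q : G[X], q.map G.subtype = f X) :
    ∃ f₁ : (MvPolynomial ι ℤ)[X] →+* G[X], ∀ q, (f₁ q).map G.subtype = f q := by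
  choose c hc using hC
  obtain ⟨x, hx⟩ := hX
  let f₁ : (MvPolynomial ι ℤ)[X] →+* G[X] :=
    eval₂RingHom (MvPolynomial.aeval c : MvPolynomial ι ℤ →ₐ[ℤ] G[X]).toRingHom x
  have h : (mapRingHom G.subtype).comp f₁ = f := by
    refine ringHom_ext' (MvPolynomial.ringHom_ext (fun n => by simp) fun i => ?_) ?_
    · simpa [f₁] using hc i
    · simpa [f₁] using hx
  exact ⟨f₁, fun q => RingHom.congr_fun h q⟩

namespace MvPowerSeries

theorem coe_map_eval₂_coordinates {k : Type*} [Field k] {d : ℕ}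
    (G : Subring (MvPowerSeries (Fin d) k)) (hX : ∀ i, MvPowerSeries.X i ∈ G)
    (t : MvPolynomial (Fin (d + 1)) ℤ) :
    (((t.eval₂ (Int.castRingHom G[X])
      (Fin.cases Polynomial.X fun i => Polynomial.C ⟨_, hX i⟩)).map G.subtype :
        (MvPowerSeries (Fin d) k)[X]) : PowerSeries (MvPowerSeries (Fin d) k)) =
      finSuccEquiv k d (t.eval₂ (Int.castRingHom _) MvPowerSeries.X) := by
  refine MvPolynomial.map_eval₂_intCast_eq ((Polynomial.coeToPowerSeries.ringHom
    (R := MvPowerSeries (Fin d) k)).comp (mapRingHom G.subtype))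
    (finSuccEquiv k d).toRingEquiv.toRingHom (fun j => ?_) t
  induction j using Fin.cases with
  | zero =>
    refine Eq.trans ?_ (finSuccEquiv_X_zero (R := k)).symm
    simp
  | succ j =>
    refine Eq.trans ?_ (finSuccEquiv_X_succ (R := k) j).symm
    simp

theorem HasCharPSpecialization.exists_ringHom_eq_zero {k : Type u} [Field k] {d : ℕ}
    (hk : HasCharPSpecialization k d) {ι J : Type*} [Finite ι] [Finite J]
    (f : (MvPolynomial ι ℤ)[X] →+* MvPowerSeries (Fin (d + 1)) k)
    {h D E E' : (MvPolynomial ι ℤ)[X]} {N : J → (MvPolynomial ι ℤ)[X]} (hh : f h = 0)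
    (hE : D * E = derivative h * E') (hreg : restrictAxis (f (D * E)) ≠ 0)
    (hnu : ¬ IsUnit (f (D * E))) (hN : ∀ j, f D ∣ f (N j)) :
    ∃ (k' : Type u) (_ : Field k') (p : ℕ) (_ : p.Prime) (_ : CharP k' p)
      (f' : (MvPolynomial ι ℤ)[X] →+* MvPowerSeries (Fin (d + 1)) k'),
      f' h = 0 ∧ f' (D * E) ≠ 0 ∧ (∀ j, f' D ∣ f' (N j)) ∧
      ∀ i (t : MvPolynomial (Fin (d + 1)) ℤ), f (Polynomial.C (MvPolynomial.X i)) =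
          t.eval₂ (Int.castRingHom (MvPowerSeries (Fin (d + 1)) k)) MvPowerSeries.X →
        f' (Polynomial.C (MvPolynomial.X i)) =
          t.eval₂ (Int.castRingHom (MvPowerSeries (Fin (d + 1)) k')) MvPowerSeries.X := by
  classical
  have := Fintype.ofFinite ι
  have := Fintype.ofFinite J
  have := isAdicComplete_maximalIdeal k d
  have : IsDomain (MvPowerSeries (Fin d) k) := NoZeroDivisors.to_isDomain _
  let g := (finSuccEquiv k d).toRingHom.comp f
  have hg : ∀ q, g q = finSuccEquiv k d (f q) := fun q => rfl
  obtain ⟨f₀, P, U, H, V, hP, hP0, hU, hf₀h, hf₀D, hf₀N, hf₀⟩ :=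
    Polynomial.exists_ringHom_approximation g (h := h) (D := D) (E := E) (N := N)
      (by rw [hg, hh, map_zero])
      (by
        intro h0
        refine hreg (PowerSeries.ext fun n => ?_)
        have h1 := congrArg (PowerSeries.coeff n) h0
        rw [PowerSeries.coeff_map, map_zero, residue_eq_zero_iff, mem_maximalIdeal,
          mem_nonunits_iff, isUnit_iff_constantCoeff, isUnit_iff_ne_zero, not_not] at h1
        rw [map_zero]
        exact h1)
      (by rwa [hg, MulEquiv.isUnit_map])
      (fun j => by
        rw [hg, hg]
        exact map_dvd _ (hN j))
  obtain ⟨k', _, p, hp, hcp, G, hX, θ, hT, hθX, hθC, hθm, hθu, hθn⟩ := hk.polynomial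
    ({P, U, H, f₀ Polynomial.X} ∪ Finset.univ.image V ∪
      Finset.univ.image fun i => f₀ (Polynomial.C (MvPolynomial.X i)))
  obtain ⟨f₁, hf₁⟩ := Polynomial.exists_comp_mapRingHom_eq G f₀ (fun i => hT _ (by simp))
    (hT _ (by simp))
  obtain ⟨P, rfl⟩ := hT P (by simp)
  obtain ⟨U, rfl⟩ := hT U (by simp)
  obtain ⟨H, rfl⟩ := hT H (by simp)
  choose V hV using fun j => hT (V j) (by simp)
  have hinj : Function.Injective (Polynomial.map G.subtype) :=
    Polynomial.map_injective _ G.subtype_injective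
  have hf₁h : f₁ h = P ^ 4 * H := hinj (by rw [hf₁, hf₀h]; simp)
  have hf₁D : f₁ (D * E) = P * U := hinj (by rw [hf₁, hf₀D]; simp)
  have hf₁N : ∀ j, f₁ (N j * E) = P * V j := fun j =>
    hinj (by rw [hf₁, hf₀N, ← hV]; simp)
  have : IsDomain (MvPowerSeries (Fin (d + 1)) k') := NoZeroDivisors.to_isDomain _
  have := henselianLocalRing k' (d + 1)
  obtain ⟨f', hf'C, hf'h, hf'D, hf'N⟩ := HenselianLocalRing.exists_ringHom_eq_zero (θ.comp f₁) hE
    (hθm P (monic_of_injective G.subtype_injective hP)) (hθn P (by simp) hP0)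
    (hθu U (by simp) hU) (H := θ H) (N := N) (by simp [hf₁h]) (by simp [hf₁D, -map_mul]; simp)
    (fun j => ⟨θ (V j), by rw [RingHom.comp_apply, hf₁N, map_mul]⟩)
  refine ⟨k', _, p, hp, hcp, f', hf'h, hf'D, hf'N, fun i t ht => ?_⟩
  let v : Fin (d + 1) → G[X] := Fin.cases Polynomial.X fun i => Polynomial.C ⟨_, hX i⟩
  have hv : f₁ (Polynomial.C (MvPolynomial.X i)) = t.eval₂ (Int.castRingHom _) v := by
    refine hinj ?_
    rw [hf₁]
    refine hf₀ i _ ?_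
    rw [hg, ht]
    exact (coe_map_eval₂_coordinates G hX t).symm
  have h2 := RingHom.congr_fun hf'C (MvPolynomial.X i)
  rw [RingHom.comp_apply, RingHom.comp_apply, RingHom.comp_apply, hv] at h2
  rw [h2]
  refine MvPolynomial.map_eval₂_intCast_eq θ (RingHom.id _) (fun j => ?_) t
  induction j using Fin.cases with
  | zero => exact hθX
  | succ j => exact hθC j

end MvPowerSeries

end

section

open IsLocalRing Polynomial

theorem Int.isJacobsonRing : IsJacobsonRing ℤ := by
  refine isJacobsonRing_iff_prime_eq.2 fun P hP => ?_
  by_cases h : P = ⊥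
  · subst h
    refine le_antisymm (fun x hx => ?_) Ideal.le_jacobson
    have h1 := Int.isUnit_iff.1 (Ideal.mem_jacobson_bot.1 hx 3)
    rw [Ideal.mem_bot]
    omega
  · have := IsPrime.to_maximal_ideal h
    exact Ideal.jacobson_eq_self_of_isMaximal

theorem CharP.exists_of_finiteType_int {A K : Type*} [CommRing A] [Algebra ℤ A]
    [Algebra.FiniteType ℤ A] [Field K] (f : A →+* K) (hf : Function.Surjective f) :
    ∃ p : ℕ, p.Prime ∧ CharP K p := by
  have : Algebra.FiniteType ℤ K := .of_surjective
    { f with commutes' := fun r => by simp } hf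
  obtain ⟨p, hp⟩ := CharP.exists K
  obtain h | rfl := CharP.char_is_prime_or_zero K p
  · exact ⟨p, h, hp⟩
  · have : CharZero K := CharP.charP_to_charZero K
    have := Int.isJacobsonRing
    have : Module.Finite ℤ K := finite_of_finite_type_of_isJacobsonRing ℤ K
    exact absurd (isField_of_isIntegral_of_isField (R := ℤ) (S := K)
      (RingHom.injective_int _) (Field.toIsField K)) Int.not_isField

namespace MvPowerSeries

theorem HasCharPSpecialization.zero (k : Type u) [Field k] : HasCharPSpecialization k 0 := by
  classical
  rintro G ⟨S, hS⟩ hX g hg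
  have : IsDomain (MvPowerSeries (Fin 0) k) := NoZeroDivisors.to_isDomain _
  have : Algebra.FiniteType ℤ G := ⟨⟨S.subtype (· ∈ G),
    Subring.adjoin_int_eq_top hS fun x hx => by simp [Finset.mem_coe.1 hx]⟩⟩
  have hle : Submonoid.powers g ≤ nonZeroDivisors G :=
    powers_le_nonZeroDivisors_of_noZeroDivisors hg
  have : Nontrivial (Localization.Away g) :=
    (IsLocalization.injective (Localization.Away g) hle).nontrivial
  obtain ⟨m, hm⟩ := Ideal.exists_maximal (Localization.Away g)
  let _ := Ideal.Quotient.field m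
  have : Algebra.FiniteType G (Localization.Away g) := inferInstance
  have : Algebra.FiniteType ℤ (Localization.Away g) := .trans ‹_› this
  obtain ⟨p, hp, hcp⟩ := CharP.exists_of_finiteType_int (Ideal.Quotient.mk m)
    Ideal.Quotient.mk_surjective
  refine ⟨Localization.Away g ⧸ m, _, p, hp, hcp, (MvPowerSeries.C).comp
    ((Ideal.Quotient.mk m).comp (algebraMap G _)), fun i => i.elim0, ?_⟩
  exact (((IsLocalization.Away.algebraMap_isUnit (S := Localization.Away g) g).map
    (Ideal.Quotient.mk m)).map
    (MvPowerSeries.C (σ := Fin 0))).ne_zero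

end MvPowerSeries

end

section

open IsLocalRing Polynomial

namespace MvPowerSeries

theorem algebraicIndependent_X_int {k : Type*} [Field k] [CharZero k] {n : ℕ}
    (G : Subring (MvPowerSeries (Fin n) k)) (hX : ∀ i, MvPowerSeries.X i ∈ G) :
    AlgebraicIndependent ℤ (fun i => (⟨_, hX i⟩ : G)) := by
  rw [algebraicIndependent_iff_injective_aeval, injective_iff_map_eq_zero]
  intro t ht
  rw [MvPolynomial.aeval_def, algebraMap_int_eq] at ht
  have h1 := MvPolynomial.map_eval₂_intCast_eq G.subtype
    (MvPolynomial.coeToMvPowerSeries.ringHom (σ := Fin n) (R := k))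
    (v := fun i => (⟨_, hX i⟩ : G)) (w := MvPolynomial.X) (fun i => by simp) t
  rw [ht, map_zero] at h1
  have h2 := MvPolynomial.coe_injective _ k (h1.symm.trans MvPolynomial.coe_zero.symm)
  refine MvPolynomial.map_injective (Int.castRingHom k) (RingHom.injective_int _) ?_
  rw [map_zero]
  refine Eq.trans ?_ h2
  rw [← MvPolynomial.eval₂_eta (MvPolynomial.map (Int.castRingHom k) t),
    MvPolynomial.eval₂_map, RingHom.eq_intCast' (MvPolynomial.C.comp (Int.castRingHom k))]

theorem HasCharPSpecialization.succ {k : Type u} [Field k] [CharZero k] {d : ℕ}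
    (hk : HasCharPSpecialization k d) : HasCharPSpecialization k (d + 1) := by
  classical
  rintro G ⟨S, hS⟩ hX g hg
  have : IsDomain (MvPowerSeries (Fin (d + 1)) k) := NoZeroDivisors.to_isDomain _
  have : CharZero (MvPowerSeries (Fin (d + 1)) k) :=
    charZero_of_injective_algebraMap (R := k) (FaithfulSMul.algebraMap_injective _ _)
  let Z : Finset G := S.subtype (· ∈ G) ∪ Finset.univ.image (fun i => ⟨_, hX i⟩) ∪ {g}
  have hZ : Algebra.adjoin ℤ (Z : Set G) = ⊤ :=
    Subring.adjoin_int_eq_top hS fun x hx => by simp [Z, Finset.mem_coe.1 hx]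
  have hgZ : g ∈ Z := by simp [Z]
  obtain ⟨ι, _, f, h, D, N, hy, hh, hderiv, hD, hN, hdvd⟩ :=
    exists_polynomial_presentation (algebraicIndependent_X_int G hX) Z hZ
      (fun i => by simp [Z])
  choose y hy using hy
  let E' := D * N ⟨g, hgZ⟩ * Polynomial.C (MvPolynomial.X (y 0))
  let E := derivative h * N ⟨g, hgZ⟩ * Polynomial.C (MvPolynomial.X (y 0))
  have hE : D * E = derivative h * E' := by simp only [E, E']; ring
  have hX0 : (⟨_, hX 0⟩ : G) ≠ 0 := by
    intro h0
    have h1 := congrArg (coeff (Finsupp.single 0 1)) (congrArg Subtype.val h0)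
    simp at h1
  have hDE : ((f (D * E) : G) : MvPowerSeries (Fin (d + 1)) k) ≠ 0 := by
    rw [Ne, Subring.coe_eq_zero_iff]
    simp only [E, map_mul, ← hN, hy]
    exact mul_ne_zero hD (mul_ne_zero (mul_ne_zero hderiv (mul_ne_zero hD hg)) hX0)
  obtain ⟨e, he, hreg⟩ := exists_restrictAxis_subst_shear_ne_zero hDE
  let σ : G →+* MvPowerSeries (Fin (d + 1)) k :=
    (substAlgHom (R := k) (hasSubst_shear 1 he)).toRingHom.comp G.subtype
  have hσ : ∀ x, σ x = subst (shear k 1 e) (x : MvPowerSeries (Fin (d + 1)) k) := fun x => by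
    rw [← coe_substAlgHom (hasSubst_shear 1 he)]
    rfl
  obtain ⟨k', _, p, hp, hcp, f', hf'h, hf'D, hf'N, hf'⟩ := hk.exists_ringHom_eq_zero (σ.comp f)
    (N := N) (by rw [RingHom.comp_apply, hh, map_zero]) hE
    (by rwa [RingHom.comp_apply, hσ])
    (by
      intro hu
      have h1 := isUnit_of_dvd_unit (Dvd.intro_left (σ.comp f (D * (derivative h * N ⟨g, hgZ⟩)))
        (by rw [← map_mul, mul_assoc])) hu
      rw [RingHom.comp_apply, hy, hσ, subst_X (hasSubst_shear 1 he), isUnit_iff_constantCoeff] at h1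
      simp [shear] at h1)
    (fun j => ⟨σ j, by rw [RingHom.comp_apply σ f, RingHom.comp_apply σ f, ← hN, map_mul]⟩)
  have : IsDomain (MvPowerSeries (Fin (d + 1)) k') := NoZeroDivisors.to_isDomain _
  obtain ⟨hf'D, hf'E⟩ := mul_ne_zero_iff.1 (by rwa [map_mul] at hf'D)
  obtain ⟨φ, hφ⟩ := Subring.exists_ringHom_closure_of_dvd f f'
    (fun t ht => by
      obtain ⟨q, rfl⟩ := hdvd t ht
      rw [map_mul, hf'h, zero_mul]) (fun z : Z => (z : G)) hN hf'D hf'N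
  have hmem : ∀ x : G, x ∈ Subring.closure (Set.range fun z : Z => (z : G)) := by
    intro x
    have h1 : Algebra.adjoin ℤ (Z : Set G) ≤ subalgebraOfSubring
        (Subring.closure (Set.range fun z : Z => (z : G))) :=
      Algebra.adjoin_le fun z hz => Subring.subset_closure ⟨⟨z, hz⟩, rfl⟩
    exact h1 (hZ ▸ trivial)
  let ψ : G →+* MvPowerSeries (Fin (d + 1)) k' :=
    (substAlgHom (R := k') (hasSubst_shear (-1) he)).toRingHom.comp
      (φ.comp ((RingHom.id G).codRestrict _ hmem))
  have hψ : ∀ x, ψ x = subst (shear k' (-1) e) (φ ⟨x, hmem x⟩) := fun x => by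
    rw [← coe_substAlgHom (hasSubst_shear (-1) he)]
    rfl
  refine ⟨k', _, p, hp, hcp, ψ, fun i => ?_, fun h0 => ?_⟩
  · have h1 := hφ ⟨⟨_, hX i⟩, hmem _⟩ 1 (Polynomial.C (MvPolynomial.X (y i)))
      (by rw [map_one, one_mul, hy])
    rw [map_one, one_mul] at h1
    rw [hψ, h1]
    have h2 : f' (Polynomial.C (MvPolynomial.X (y i))) = shear k' 1 e i := by
      refine (hf' (y i) (Fin.cases (.X 0) (fun j => .X j.succ + .X 0 ^ e j.succ) i) ?_).trans ?_
      · rw [RingHom.comp_apply, hy, hσ, subst_X (hasSubst_shear 1 he)]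
        induction i using Fin.cases <;> simp [shear]
      · induction i using Fin.cases <;> simp [shear]
    rw [h2, ← subst_X (R := k') (hasSubst_shear 1 he), subst_shear_subst_shear he]
  · rw [hψ] at h0
    have h1 := hφ ⟨g, hmem g⟩ D (N ⟨g, hgZ⟩) (hN ⟨g, hgZ⟩)
    have h2 := subst_shear_subst_shear (c := -1) he (φ ⟨g, hmem g⟩)
    rw [h0, ← coe_substAlgHom (R := k') (hasSubst_shear (-(-1)) he), map_zero] at h2
    rw [← h2, mul_zero] at h1
    exact hf'E (by simp only [E, map_mul, ← h1, mul_zero, zero_mul])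

end MvPowerSeries

end

theorem MvPowerSeries.hasCharPSpecialization (k : Type u) [Field k] [CharZero k] (d : ℕ) :
    HasCharPSpecialization k d := by
  induction d with
  | zero => exact .zero k
  | succ d ih => exact ih.succ

section

open scoped TensorProduct

theorem Module.exists_almost_free {A M : Type*} [CommRing A] [IsDomain A] [AddCommGroup M]
    [Module A M] [Module.IsTorsionFree A M] [Module.Finite A M] [Nontrivial M] :
    ∃ (h : ℕ) (_ : 0 < h) (α : (Fin h → A) →ₗ[A] M) (β : M →ₗ[A] (Fin h → A)) (c : A), c ≠ 0 ∧
      (∀ x, α (β x) = c • x) ∧ ∀ x, β (α x) = c • x := by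
  classical
  obtain ⟨T, hT⟩ := Module.Finite.fg_top (R := A) (M := M)
  obtain ⟨I, hI, hmax⟩ := exists_maximal_linearIndepOn A (fun t : T => (t : M))
  let e : I ≃ Fin (Fintype.card I) := Fintype.equivFin I
  let b : Fin (Fintype.card I) → M := fun i => ((e.symm i : T) : M)
  have hb : LinearIndependent A b :=
    (linearIndependent_equiv' e.symm rfl).2 hI
  let α : (Fin (Fintype.card I) → A) →ₗ[A] M := Fintype.linearCombination A b
  have hα : Function.Injective α := hb.fintypeLinearCombination_injective
  have hr : LinearMap.range α = Submodule.span A ((fun t : T => (t : M)) '' I) := by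
    rw [Fintype.range_linearCombination]
    congr 1
    ext x
    constructor
    · rintro ⟨i, rfl⟩; exact ⟨e.symm i, (e.symm i).2, rfl⟩
    · rintro ⟨t, ht, rfl⟩; exact ⟨e ⟨t, ht⟩, by simp [b]⟩
  have h1 : ∀ t : T, ∃ a : A, a ≠ 0 ∧ a • (t : M) ∈ LinearMap.range α := by
    intro t
    by_cases ht : t ∈ I
    · exact ⟨1, one_ne_zero, by rw [hr, one_smul]; exact Submodule.subset_span ⟨t, ht, rfl⟩⟩
    · rw [hr]; exact hmax t ht
  choose a ha ha' using h1
  have hc : ∀ x, (∏ t, a t) • x ∈ LinearMap.range α := by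
    intro x
    have hx : x ∈ Submodule.span A (T : Set M) := hT ▸ Submodule.mem_top
    induction hx using Submodule.span_induction with
    | mem x hx =>
      rw [← Finset.prod_erase_mul _ _ (Finset.mem_univ ⟨x, hx⟩), mul_smul]
      exact Submodule.smul_mem _ _ (ha' ⟨x, hx⟩)
    | zero => simp
    | add u v _ _ hu hv => rw [smul_add]; exact add_mem hu hv
    | smul r u _ hu => rw [smul_comm]; exact Submodule.smul_mem _ _ hu
  have hc0 : (∏ t, a t) ≠ 0 := Finset.prod_ne_zero_iff.2 fun t _ => ha t
  let β : M →ₗ[A] (Fin (Fintype.card I) → A) :=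
    (LinearEquiv.ofInjective α hα).symm.toLinearMap ∘ₗ
      LinearMap.codRestrict (LinearMap.range α) (LinearMap.lsmul A M (∏ t, a t)) hc
  have hαβ : ∀ x, α (β x) = (∏ t, a t) • x := by
    intro x
    have := LinearEquiv.apply_symm_apply (LinearEquiv.ofInjective α hα)
      (LinearMap.codRestrict (LinearMap.range α) (LinearMap.lsmul A M (∏ t, a t)) hc x)
    exact congrArg Subtype.val this
  refine ⟨_, ?_, α, β, ∏ t, a t, hc0, hαβ, fun x => hα ?_⟩
  · by_contra h0
    obtain ⟨x, hx⟩ := exists_ne (0 : M)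
    have hz : β x = 0 := by
      ext i; exact absurd (Nat.zero_lt_of_lt i.2) h0
    have := hαβ x
    rw [hz, map_zero, eq_comm, smul_eq_zero] at this
    exact this.elim hc0 hx
  · rw [hαβ, map_smul]

theorem ComplexCertificate.not_of_charZero {k B : Type u} [Field k] [CharZero k] [CommRing B]
    [IsDomain B] {d N n r : ℕ} (ψ : MvPowerSeries (Fin d) k →+* B) (δ : Fin r → B)
    (hψ : Function.Injective ψ) (hψi : ψ.IsIntegral)
    (hδ : ∀ i, δ i ^ n ∈ Ideal.span (Set.range fun i => ψ (MvPowerSeries.X i))) :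
    ¬ ComplexCertificate r d (fun i => ψ (MvPowerSeries.X i ^ N)) δ := by
  classical
  intro hcert
  obtain ⟨S, hS⟩ := hcert.exists_finset
  choose hcoef hcoefeq using fun i => Ideal.mem_span_range_iff_exists_fun.1 (hδ i)
  let T : Finset B := S ∪ Finset.univ.image δ ∪
    Finset.univ.image fun x : Fin r × Fin d => hcoef x.1 x.2
  choose q hq hq' using fun b : B => hψi b
  let C : Finset (MvPowerSeries (Fin d) k) :=
    Finset.univ.image MvPowerSeries.X ∪ T.biUnion fun t => (q t).coeffs
  let G : Subring (MvPowerSeries (Fin d) k) := Subring.closure C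
  have hXG : ∀ i, MvPowerSeries.X i ∈ G := fun i =>
    Subring.subset_closure (by simp [C])
  let _ : Algebra G B := (ψ.comp G.subtype).toAlgebra
  have hmap : ∀ x : G, algebraMap G B x = ψ x := fun x => rfl
  have hinj : Function.Injective (algebraMap G B) := hψ.comp Subtype.val_injective
  have hTint : ∀ t ∈ T, IsIntegral G t := by
    intro t ht
    have hc : (↑(q t).coeffs : Set (MvPowerSeries (Fin d) k)) ⊆ G := by
      refine subset_trans (fun x hx => ?_) Subring.subset_closure
      simp only [C, Finset.coe_union, Finset.coe_biUnion]
      exact Or.inr (Set.mem_biUnion (Finset.mem_coe.2 ht) hx)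
    refine ⟨(q t).toSubring G hc, (Polynomial.monic_toSubring ..).2 (hq t), ?_⟩
    have : algebraMap G B = ψ.comp G.subtype := rfl
    rw [this, ← Polynomial.eval₂_map, Polynomial.map_toSubring]
    exact hq' t
  let R₁ : Subalgebra G B := Algebra.adjoin G (T : Set B)
  have hfin : Module.Finite G R₁ :=
    Module.Finite.iff_fg.2 (fg_adjoin_of_finite T.finite_toSet hTint)
  have htf : Module.IsTorsionFree G R₁ := by
    have : FaithfulSMul G R₁ := (faithfulSMul_iff_algebraMap_injective G R₁).2
      fun x y hxy => hinj (congrArg Subtype.val hxy)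
    infer_instance
  have hTR : ∀ t ∈ T, t ∈ R₁ := fun t ht => Algebra.subset_adjoin ht
  let Y : Fin d → G := fun i => ⟨MvPowerSeries.X i, hXG i⟩
  let δ₁ : Fin r → R₁ := fun i => ⟨δ i, hTR _ (by simp [T])⟩
  let h₁ : Fin r → Fin d → R₁ := fun i j => ⟨hcoef i j, hTR _ (by
    simp only [T, Finset.mem_union, Finset.mem_image, Finset.mem_univ, true_and]
    exact Or.inr ⟨(i, j), rfl⟩)⟩
  have hcert₁ : ComplexCertificate r d (fun i => algebraMap G R₁ (Y i ^ N)) δ₁ :=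
    hS R₁.toSubring (fun x hx => hTR x (by
      simp only [T, Finset.mem_union]; exact Or.inl (Or.inl hx)))
      (fun i => algebraMap G R₁ (Y i ^ N)) δ₁ (fun i => rfl) fun i => rfl
  have hδ₁ : ∀ i, ∑ j, h₁ i j * algebraMap G R₁ (Y j) = δ₁ i ^ n := by
    intro i
    apply Subtype.val_injective
    have := hcoefeq i
    simpa [δ₁, h₁, Y, hmap] using! this
  have : IsDomain (MvPowerSeries (Fin d) k) := NoZeroDivisors.to_isDomain _
  have : IsDomain G := inferInstance
  obtain ⟨h, hh, α, β, c, hc, hαβ, hβα⟩ := Module.exists_almost_free (A := G) (M := R₁)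
  obtain ⟨k', _, p, hp, _, φ, hφX, hφc⟩ :=
    MvPowerSeries.hasCharPSpecialization _ _ G ⟨C, rfl⟩ hXG c hc
  let _ : Algebra G (MvPowerSeries (Fin d) k') := φ.toAlgebra
  have hφ : ∀ x, algebraMap G (MvPowerSeries (Fin d) k') x = φ x := fun x => rfl
  let A' := MvPowerSeries (Fin d) k'
  have : IsDomain A' := NoZeroDivisors.to_isDomain _
  have : CharP A' p := charP_of_injective_algebraMap
    (algebraMap k' (MvPowerSeries (Fin d) k')).injective p
  let E := TensorProduct.piScalarRight G A' A' (Fin h)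
  let α' : (Fin h → A') →ₗ[A'] A' ⊗[G] R₁ := (α.baseChange A') ∘ₗ E.symm.toLinearMap
  let β' : A' ⊗[G] R₁ →ₗ[A'] (Fin h → A') := E.toLinearMap ∘ₗ (β.baseChange A')
  have hαβ' : ∀ x, (α.baseChange A') ((β.baseChange A') x) = φ c • x := by
    intro x
    induction x with
    | zero => simp
    | add x y hx hy => rw [map_add, map_add, hx, hy, smul_add]
    | tmul a b =>
      rw [LinearMap.baseChange_tmul, LinearMap.baseChange_tmul, hαβ, TensorProduct.tmul_smul,
        ← hφ, algebraMap_smul]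
  have hβα' : ∀ x, (β.baseChange A') ((α.baseChange A') x) = φ c • x := by
    intro x
    induction x with
    | zero => simp
    | add x y hx hy => rw [map_add, map_add, hx, hy, smul_add]
    | tmul a b =>
      rw [LinearMap.baseChange_tmul, LinearMap.baseChange_tmul, hβα, TensorProduct.tmul_smul,
        ← hφ, algebraMap_smul]
  let ι : R₁ →+* A' ⊗[G] R₁ :=
    (Algebra.TensorProduct.includeRight : R₁ →ₐ[G] A' ⊗[G] R₁).toRingHom
  have hι : ∀ x : G, ι (algebraMap G R₁ x) = algebraMap A' (A' ⊗[G] R₁) (φ x) := by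
    intro x
    rw [← hφ, ← IsScalarTower.algebraMap_apply]
    exact AlgHom.commutes _ x
  refine ComplexCertificate.not_of_charP (A := A') hp (R := A' ⊗[G] R₁) (X := MvPowerSeries.X)
    (N := N) (n := n)
    (fun M j x v => MvPowerSeries.X_pow_weaklyRegular M j x v)
    (fun x => MvPowerSeries.eq_zero_of_forall_mem_span_X_pow x)
    hh α' β' (φ c) hφc (fun x => ?_) (fun x => ?_) (fun i => ι (δ₁ i)) (fun i => ?_) ?_
  · simp only [α', β', LinearMap.comp_apply, LinearEquiv.coe_coe, LinearEquiv.symm_apply_apply]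
    exact hαβ' x
  · simp only [α', β', LinearMap.comp_apply, LinearEquiv.coe_coe, hβα', map_smul,
      LinearEquiv.apply_symm_apply]
  · rw [← map_pow, ← hδ₁, map_sum]
    refine Ideal.sum_mem _ fun j _ => ?_
    rw [map_mul, hι, hφX]
    exact Ideal.mul_mem_left _ _ (Ideal.subset_span ⟨j, rfl⟩)
  · have := hcert₁.map ι
    simp only [hι, map_pow, Y, hφX] at this ⊢
    exact this

end

theorem asymptotic_improved_new_intersection
    (m r l : ℕ) (hm : 0 < m) (hr : 0 < r) (hl : 0 < l) :
    ∃ κ : ℕ, ∀ (R : Type u) [CommRing R] [IsLocalRing R] [IsNoetherianRing R] (p : ℕ),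
      p.Prime → CharZero R → CharP (IsLocalRing.ResidueField R) p → κ ≤ p →
      (∃ t : Finset R, t.card ≤ m ∧
        Ideal.span (t : Set R) = IsLocalRing.maximalIdeal R) →
      ∀ (s : ℕ) (k : ℕ → ℕ)
        (d : ∀ i : ℕ, ((Fin (k (i + 1)) → R) →ₗ[R] (Fin (k i) → R))),
        (∀ i, k i ≤ r) → (∀ i, s < i → k i = 0) →
        (∀ i, (d i).comp (d (i + 1)) = 0) →
        (∀ i, modLength R
            (LinearMap.ker (d i) ⧸
              Submodule.comap (LinearMap.ker (d i)).subtype (LinearMap.range (d (i + 1))))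
          ≤ (l : WithBot ℕ∞)) →
        ∀ μ : (Fin (k 0) → R) ⧸ LinearMap.range (d 0),
          μ ≠ 0 →
          μ ∉ (IsLocalRing.maximalIdeal R) •
            (⊤ : Submodule R ((Fin (k 0) → R) ⧸ LinearMap.range (d 0))) →
          modLength R (Submodule.span R {μ}) ≤ (l : WithBot ℕ∞) →
          ringKrullDim R ≤ (s : WithBot ℕ∞) := by
  classical
  by_contra! h
  choose R i₁ i₂ i₃ p hp _ hchar hκ ht s k d hk hks hd hH μ _ hμ hμl hdim using h
  have hx : ∀ n, ∃ x : Fin m → R n, Ideal.span (Set.range x) = IsLocalRing.maximalIdeal (R n) := by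
    intro n
    obtain ⟨t, htm, hts⟩ := ht n
    refine ⟨fun i => if hi : i.1 < t.card then (t.equivFin.symm ⟨i, hi⟩ : R n) else 0, ?_⟩
    rw [← hts]
    apply le_antisymm
    · rw [Ideal.span_le]
      rintro _ ⟨i, rfl⟩
      dsimp only
      split_ifs with hi
      · exact Ideal.subset_span (t.equivFin.symm ⟨i, hi⟩).2
      · exact zero_mem _
    · refine Ideal.span_mono fun a ha => ?_
      refine ⟨⟨t.equivFin ⟨a, ha⟩, (t.equivFin ⟨a, ha⟩).2.trans_le htm⟩, ?_⟩
      simp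
  choose x hx using hx
  obtain ⟨K, B, _, _, _, _, D, N, n, ψ, δ, hψ, hψi, hδ, hcert⟩ :=
    exists_bad_domain R p hκ hchar x hx s hdim fun n D hD y hy =>
      exists_complexCertificate (k n) (d n) (hk n) (hks n) (hd n) (hH n) (μ n) (hμ n) (hμl n)
        hD y hy
  exact ComplexCertificate.not_of_charZero ψ δ hψ hψi hδ hcert
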